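/- arXiv:2512.03468 — 3 statements merged into one kernel-verified Lean document; each statement's English description precedes it below -/
import Mathlib

section
/- Let P and Q be nonzero integers with D = P^2 - 4Q ≠ 0, let U = U(P,Q) be nondegenerate, and let p be a prime with p ∣ D and p ∤ gcd(P,Q). Then for every integer n > 1 with gcd(p,n) = 1 and every integer k ≥ 1 one has M^U_{p^k n} ≡ 1 (mod p^k); that is, there exists an integer t such that M^U_{p^k n} = 1 + p^k·t. -/
/-- Lucas sequence of the first kind: `U 0 = 0`, `U 1 = 1`,
`U (n+2) = P * U (n+1) - Q * U n`. -/
def lucasU (P Q : ℤ) : ℕ → ℤ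
  | 0 => 0
  | 1 => 1
  | n + 2 => P * lucasU P Q (n + 1) - Q * lucasU P Q n

/-- Möbius dual of the Lucas sequence of the first kind:
`M^U_n = ∏_{d ∣ n} U_d ^ μ(n/d)`, as a rational number. -/
def mobiusDualU (P Q : ℤ) (n : ℕ) : ℚ :=
  ∏ d ∈ n.divisors, (lucasU P Q d : ℚ) ^ (ArithmeticFunction.moebius (n / d))

open MvPolynomial in
/-- Symmetric bivariate polynomials are polynomials in `a + b` and `a * b`. -/
theorem exists_of_symm (s : MvPolynomial (Fin 2) ℤ)
    (hs : rename (Equiv.swap (0 : Fin 2) 1) s = s) :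
    ∃ g : MvPolynomial (Fin 2) ℤ, ∀ (R : Type) [CommRing R] (a b : R),
      aeval ![a, b] s = aeval ![a + b, a * b] g := by
  have hsym : s.IsSymmetric := by
    intro e
    have he : e = 1 ∨ e = Equiv.swap 0 1 := by
      revert e; decide
    rcases he with rfl | rfl
    · simp
    · exact hs
  obtain ⟨g, hg⟩ := esymmAlgHom_surjective ℤ (σ := Fin 2) (n := 2) (by simp) ⟨s, hsym⟩
  have hg' := congrArg Subtype.val hg
  rw [esymmAlgHom_apply] at hg'
  simp only at hg'
  refine ⟨g, fun R _ a b => ?_⟩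
  rw [← hg', ← AlgHom.comp_apply, comp_aeval]
  congr 2
  funext i
  have h1 : esymm (Fin 2) ℤ 1 = X 0 + X 1 := by
    rw [esymm_one]; simp
  have h2 : esymm (Fin 2) ℤ 2 = X 0 * X 1 := by
    have : Finset.powersetCard 2 (Finset.univ : Finset (Fin 2)) = {Finset.univ} := by decide
    rw [esymm, this]; simp
  fin_cases i
  · simp [h1]
  · simp [h2]

/-- Homogenized cyclotomic polynomial. -/
noncomputable def cycH (n : ℕ) : MvPolynomial (Fin 2) ℤ :=
  (Polynomial.cyclotomic n ℤ).homogenize (Nat.totient n)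

theorem cycH_prod (n : ℕ) (hn : 0 < n) :
    ∏ d ∈ n.divisors, cycH d = MvPolynomial.X 0 ^ n - MvPolynomial.X 1 ^ n := by
  unfold cycH
  rw [← Polynomial.homogenize_finsetProd
    (fun i _ => (Polynomial.natDegree_cyclotomic i ℤ).le),
    Polynomial.prod_cyclotomic_eq_X_pow_sub_one hn, Nat.sum_totient,
    Polynomial.homogenize_sub, Polynomial.homogenize_X_pow le_rfl, Polynomial.homogenize_one]
  simp

theorem cycH_one : cycH 1 = MvPolynomial.X 0 - MvPolynomial.X 1 := by
  have := cycH_prod 1 one_pos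
  simpa using this

theorem X_pow_sub_ne (n : ℕ) (hn : 0 < n) :
    (MvPolynomial.X 0 ^ n - MvPolynomial.X 1 ^ n : MvPolynomial (Fin 2) ℤ) ≠ 0 := by
  intro h
  have := congrArg (MvPolynomial.aeval ![(1 : ℤ), 0]) h
  simp [hn.ne'] at this

theorem cycH_swap (n : ℕ) (hn : 1 < n) :
    MvPolynomial.rename (Equiv.swap (0 : Fin 2) 1) (cycH n) = cycH n := by
  induction n using Nat.strong_induction_on with
  | _ n ih =>
    have hP := cycH_prod n (by omega)
    rw [← Nat.cons_self_properDivisors (by omega), Finset.prod_cons] at hP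
    have h1 : 1 ∈ n.properDivisors := by simp [hn]
    have hA0 : ∏ d ∈ n.properDivisors, cycH d ≠ 0 := by
      intro h
      rw [h, mul_zero] at hP
      exact X_pow_sub_ne n (by omega) hP.symm
    have hA : MvPolynomial.rename (Equiv.swap (0 : Fin 2) 1) (∏ d ∈ n.properDivisors, cycH d)
        = - ∏ d ∈ n.properDivisors, cycH d := by
      rw [← Finset.mul_prod_erase _ _ h1, map_mul, map_prod, cycH_one]
      rw [Finset.prod_congr rfl (g := cycH)]
      · simp only [map_sub, MvPolynomial.rename_X, Equiv.swap_apply_left, Equiv.swap_apply_right]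
        ring
      · intro d hd
        simp only [Finset.mem_erase, Nat.mem_properDivisors] at hd
        have : 0 < d := Nat.pos_of_dvd_of_pos hd.2.1 (by omega)
        exact ih d hd.2.2 (by omega)
    have hP2 := congrArg (MvPolynomial.rename (Equiv.swap (0 : Fin 2) 1)) hP
    rw [map_mul, hA] at hP2
    simp only [map_sub, map_pow, MvPolynomial.rename_X, Equiv.swap_apply_left,
      Equiv.swap_apply_right] at hP2
    apply mul_right_cancel₀ hA0
    rw [hP]
    linear_combination -hP2

/-- polynomial in `P`, `Q` representing the homogenized cyclotomic polynomial. -/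
theorem exists_G (n : ℕ) : ∃ g : MvPolynomial (Fin 2) ℤ, 1 < n → ∀ (R : Type) [CommRing R] (a b : R),
      MvPolynomial.aeval ![a, b] (cycH n) = MvPolynomial.aeval ![a + b, a * b] g := by
  by_cases h : 1 < n
  · obtain ⟨g, hg⟩ := exists_of_symm _ (cycH_swap n h)
    exact ⟨g, fun _ => hg⟩
  · exact ⟨0, fun h' => absurd h' h⟩

noncomputable def cycG (n : ℕ) : MvPolynomial (Fin 2) ℤ := (exists_G n).choose

theorem cycG_spec (n : ℕ) (hn : 1 < n) (R : Type) [CommRing R] (a b : R) :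
    MvPolynomial.aeval ![a, b] (cycH n) = MvPolynomial.aeval ![a + b, a * b] (cycG n) :=
  (exists_G n).choose_spec hn R a b

/-- Integer value of the homogenized cyclotomic polynomial. -/
noncomputable def cycV (n : ℕ) (P Q : ℤ) : ℤ := MvPolynomial.aeval ![P, Q] (cycG n)

theorem aeval_cast (g : MvPolynomial (Fin 2) ℤ) (R : Type) [CommRing R] (P Q : ℤ) :
    ((MvPolynomial.aeval ![P, Q] g : ℤ) : R) = MvPolynomial.aeval ![(P : R), (Q : R)] g := by
  have h := MvPolynomial.comp_aeval (R := ℤ) (![P, Q]) (Algebra.ofId ℤ R)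
  have h2 := congrArg (fun f => f g) h
  simp only [AlgHom.comp_apply] at h2
  rw [Algebra.ofId_apply] at h2
  simp only [algebraMap_int_eq, eq_intCast] at h2
  rw [h2]
  congr 2
  funext i
  fin_cases i <;> simp [Algebra.ofId_apply]

theorem cycV_cast (n : ℕ) (hn : 1 < n) (R : Type) [CommRing R] (a b : R) (P Q : ℤ)
    (hP : (P : R) = a + b) (hQ : (Q : R) = a * b) :
    (cycV n P Q : R) = MvPolynomial.aeval ![a, b] (cycH n) := by
  rw [cycV, aeval_cast, cycG_spec n hn, hP, hQ]

theorem cycH_eval (n : ℕ) (K : Type) [Field K] (a b : K) (hb : b ≠ 0) :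
    MvPolynomial.aeval ![a, b] (cycH n) =
      b ^ (Nat.totient n) * (Polynomial.cyclotomic n K).eval (a / b) := by
  have h := Polynomial.eval_homogenize (p := Polynomial.cyclotomic n K) (n := Nat.totient n)
    (Polynomial.natDegree_cyclotomic_le) ![a, b] (by simpa using hb)
  rw [← Polynomial.map_cyclotomic_int, Polynomial.homogenize_map, MvPolynomial.eval_map] at h
  rw [MvPolynomial.aeval_def]
  simp only [Polynomial.map_cyclotomic_int] at h
  rw [algebraMap_int_eq, cycH, h]
  simp [mul_comm]

/-- Companion Lucas sequence. -/
def lucasW (P Q : ℤ) : ℕ → ℤ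
  | 0 => 2
  | 1 => P
  | n + 2 => P * lucasW P Q (n + 1) - Q * lucasW P Q n

theorem lucasW_cast (R : Type) [CommRing R] (a b : R) (P Q : ℤ)
    (hP : (P : R) = a + b) (hQ : (Q : R) = a * b) (n : ℕ) :
    (lucasW P Q n : R) = a ^ n + b ^ n := by
  induction n using Nat.twoStepInduction with
  | zero => simp [lucasW]; norm_num
  | one => simp [lucasW, hP]
  | more n h1 h2 =>
    simp only [lucasW, Int.cast_sub, Int.cast_mul, h1, h2, hP, hQ]
    ring

theorem lucasU_cast (R : Type) [CommRing R] (a b : R) (P Q : ℤ)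
    (hP : (P : R) = a + b) (hQ : (Q : R) = a * b) (n : ℕ) :
    (a - b) * (lucasU P Q n : R) = a ^ n - b ^ n := by
  induction n using Nat.twoStepInduction with
  | zero => simp [lucasU]
  | one => simp [lucasU]
  | more n h1 h2 =>
    simp only [lucasU, Int.cast_sub, Int.cast_mul, hP, hQ]
    linear_combination (a + b) * h2 - a * b * h1

theorem exists_roots (K : Type) [Field K] [IsAlgClosed K] (P Q : ℤ) :
    ∃ a b : K, (P : K) = a + b ∧ (Q : K) = a * b := by
  obtain ⟨x, hx⟩ := IsAlgClosed.exists_root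
    (Polynomial.X ^ 2 - Polynomial.C (P : K) * Polynomial.X + Polynomial.C (Q : K)) (by
      have : (Polynomial.X ^ 2 - Polynomial.C (P : K) * Polynomial.X + Polynomial.C (Q : K)).degree
        = 2 := by compute_degree!
      rw [this]; decide)
  refine ⟨x, P - x, by ring, ?_⟩
  simp [Polynomial.IsRoot] at hx
  linear_combination hx

theorem lucasU_prod (P Q : ℤ) (hD : P ^ 2 - 4 * Q ≠ 0) (n : ℕ) (hn : 0 < n) :
    ∏ d ∈ n.divisors, (if d = 1 then 1 else cycV d P Q) = lucasU P Q n := by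
  obtain ⟨a, b, hP, hQ⟩ := exists_roots ℂ P Q
  have hab : a - b ≠ 0 := by
    intro h
    apply hD
    have : ((P ^ 2 - 4 * Q : ℤ) : ℂ) = 0 := by
      push_cast
      rw [hP, hQ]
      linear_combination (a - b) * h
    exact_mod_cast this
  have h1 : 1 ∈ n.divisors := by simp; omega
  have hp := congrArg (MvPolynomial.aeval ![a, b]) (cycH_prod n hn)
  rw [← Finset.mul_prod_erase _ _ h1, map_mul, map_prod, cycH_one] at hp
  simp only [map_sub, map_pow, MvPolynomial.aeval_X, Matrix.cons_val_zero, Matrix.cons_val_one]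
    at hp
  rw [← lucasU_cast ℂ a b P Q hP hQ] at hp
  have hp := mul_left_cancel₀ hab hp
  rw [← Finset.mul_prod_erase _ _ h1, if_pos rfl, one_mul]
  have : ((∏ d ∈ n.divisors.erase 1, (if d = 1 then 1 else cycV d P Q) : ℤ) : ℂ)
      = lucasU P Q n := by
    rw [← hp, Int.cast_prod]
    apply Finset.prod_congr rfl
    intro d hd
    simp only [Finset.mem_erase, Nat.mem_divisors] at hd
    have : 0 < d := Nat.pos_of_dvd_of_pos hd.2.1 hn
    rw [if_neg hd.1, cycV_cast d (by omega) ℂ a b P Q hP hQ]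
  exact_mod_cast this

theorem mobiusDualU_eq (P Q : ℤ) (hD : P ^ 2 - 4 * Q ≠ 0)
    (hnd : ∀ m : ℕ, 1 ≤ m → lucasU P Q m ≠ 0) (n : ℕ) (hn : 1 < n) :
    mobiusDualU P Q n = cycV n P Q := by
  have h := (ArithmeticFunction.prod_eq_iff_prod_pow_moebius_eq_of_nonzero (R := ℚ)
    (f := fun d => ((if d = 1 then 1 else cycV d P Q : ℤ) : ℚ))
    (g := fun d => (lucasU P Q d : ℚ)) ?_ ?_).1 ?_ n (by omega)
  · rw [if_neg (by omega)] at h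
    rw [← h, mobiusDualU, Nat.prod_divisorsAntidiagonal'
      (f := fun x y => (lucasU P Q y : ℚ) ^ (ArithmeticFunction.moebius x))]
  · intro m hm h0
    have h0' : (if m = 1 then 1 else cycV m P Q : ℤ) = 0 := by exact_mod_cast h0
    apply hnd m hm
    rw [← lucasU_prod P Q hD m hm]
    exact Finset.prod_eq_zero (i := m) (by simp; omega) h0'
  · intro m hm
    exact_mod_cast hnd m hm
  · intro m hm
    rw [← lucasU_prod P Q hD m hm]
    push_cast
    rfl

theorem cyclotomic_tower (p n : ℕ) (hp : p.Prime) (hpn : ¬ p ∣ n) (k : ℕ) (K : Type) [Field K]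
    (x : K) :
    (Polynomial.cyclotomic (p ^ (k + 1) * n) K).eval x *
      (Polynomial.cyclotomic n K).eval (x ^ p ^ k) =
      (Polynomial.cyclotomic n K).eval (x ^ p ^ (k + 1)) := by
  induction k generalizing x with
  | zero =>
    have h := congrArg (Polynomial.eval x) (Polynomial.cyclotomic_expand_eq_cyclotomic_mul hp hpn K)
    rw [Polynomial.expand_eval, Polynomial.eval_mul] at h
    simp [h, mul_comm p n]
  | succ k ih =>
    have h := congrArg (Polynomial.eval x) (Polynomial.cyclotomic_expand_eq_cyclotomic hp
      (n := p ^ (k + 1) * n) (Dvd.dvd.mul_right (dvd_pow_self p (by omega)) n) K)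
    rw [Polynomial.expand_eval] at h
    have e : p ^ (k + 1) * n * p = p ^ (k + 1 + 1) * n := by ring
    rw [e] at h
    have h2 := ih (x ^ p)
    rw [h, ← pow_mul, ← pow_mul, ← pow_succ', ← pow_succ'] at h2
    exact h2

theorem cycV_tower (P Q : ℤ) (hQ0 : Q ≠ 0) (p n : ℕ) (hp : p.Prime) (hpn : ¬ p ∣ n) (hn : 1 < n)
    (k : ℕ) :
    cycV (p ^ (k + 1) * n) P Q * cycV n (lucasW P Q (p ^ k)) (Q ^ p ^ k) =
      cycV n (lucasW P Q (p ^ (k + 1))) (Q ^ p ^ (k + 1)) := by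
  obtain ⟨a, b, hP, hQ⟩ := exists_roots ℂ P Q
  have hb : b ≠ 0 := by
    rintro rfl
    apply hQ0
    rw [mul_zero] at hQ
    exact_mod_cast hQ
  have key : ∀ m : ℕ, (cycV n (lucasW P Q m) (Q ^ m) : ℂ) =
      (b ^ m) ^ (Nat.totient n) * (Polynomial.cyclotomic n ℂ).eval ((a / b) ^ m) := by
    intro m
    rw [cycV_cast n hn ℂ (a ^ m) (b ^ m) _ _ (lucasW_cast ℂ a b P Q hP hQ m)
      (by push_cast; rw [hQ, mul_pow]), cycH_eval _ _ _ _ (pow_ne_zero _ hb), div_pow]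
  have hN : 1 < p ^ (k + 1) * n :=
    lt_of_lt_of_le hn (Nat.le_mul_of_pos_left _ (pow_pos hp.pos _))
  have : ((cycV (p ^ (k + 1) * n) P Q * cycV n (lucasW P Q (p ^ k)) (Q ^ p ^ k) : ℤ) : ℂ) =
      cycV n (lucasW P Q (p ^ (k + 1))) (Q ^ p ^ (k + 1)) := by
    push_cast
    rw [key, key, cycV_cast _ hN ℂ a b P Q hP hQ, cycH_eval _ _ _ _ hb,
      ← cyclotomic_tower p n hp hpn k ℂ (a / b)]
    have ht : (p ^ (k + 1) * n).totient + p ^ k * n.totient = p ^ (k + 1) * n.totient := by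
      rw [Nat.totient_mul (Nat.Coprime.pow_left _ ((Nat.Prime.coprime_iff_not_dvd hp).2 hpn)),
        Nat.totient_prime_pow_succ hp]
      obtain ⟨q, rfl⟩ : ∃ q, p = q + 1 := ⟨p - 1, by have := hp.pos; omega⟩
      simp
      ring
    rw [← pow_mul b, ← pow_mul b, ← ht, pow_add]
    ring
  exact_mod_cast this

theorem lucasW_comp (P Q : ℤ) (m n : ℕ) :
    lucasW (lucasW P Q m) (Q ^ m) n = lucasW P Q (m * n) := by
  obtain ⟨a, b, hP, hQ⟩ := exists_roots ℂ P Q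
  have h : (lucasW (lucasW P Q m) (Q ^ m) n : ℂ) = lucasW P Q (m * n) := by
    rw [lucasW_cast ℂ (a ^ m) (b ^ m) _ _ (lucasW_cast ℂ a b P Q hP hQ m)
      (by push_cast; rw [hQ, mul_pow]), lucasW_cast ℂ a b P Q hP hQ, pow_mul, pow_mul]
  exact_mod_cast h

theorem lucasW_prime (p : ℕ) (hp : p.Prime) : ∃ g : MvPolynomial (Fin 2) ℤ, ∀ P Q : ℤ,
    lucasW P Q p = P ^ p - p * MvPolynomial.aeval ![P, Q] g := by
  obtain ⟨r, hr⟩ := exists_add_pow_prime_eq hp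
    (MvPolynomial.X 0 : MvPolynomial (Fin 2) ℤ) (MvPolynomial.X 1)
  set s := (MvPolynomial.X 0 : MvPolynomial (Fin 2) ℤ) * (MvPolynomial.X 1) * r with hs
  have hr' : ((MvPolynomial.X 0 : MvPolynomial (Fin 2) ℤ) + MvPolynomial.X 1) ^ p =
    MvPolynomial.X 0 ^ p + MvPolynomial.X 1 ^ p + (p : MvPolynomial (Fin 2) ℤ) * s := by
    rw [hr, hs]; ring
  have hsw : MvPolynomial.rename (Equiv.swap (0 : Fin 2) 1) s = s := by
    have h2 := congrArg (MvPolynomial.rename (Equiv.swap (0 : Fin 2) 1)) hr'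
    simp only [map_add, map_mul, map_pow, map_natCast, MvPolynomial.rename_X,
      Equiv.swap_apply_left, Equiv.swap_apply_right] at h2
    have hp0 : (p : MvPolynomial (Fin 2) ℤ) ≠ 0 := by exact_mod_cast hp.ne_zero
    apply mul_left_cancel₀ hp0
    rw [add_comm (MvPolynomial.X 1), hr'] at h2
    linear_combination -h2
  obtain ⟨g, hg⟩ := exists_of_symm s hsw
  refine ⟨g, fun P Q => ?_⟩
  obtain ⟨a, b, hP, hQ⟩ := exists_roots ℂ P Q
  have h3 := congrArg (MvPolynomial.aeval ![a, b]) hr'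
  simp only [map_add, map_mul, map_pow, map_natCast, MvPolynomial.aeval_X, Matrix.cons_val_zero,
    Matrix.cons_val_one, hg] at h3
  have : (lucasW P Q p : ℂ) = ((P ^ p - p * MvPolynomial.aeval ![P, Q] g : ℤ) : ℂ) := by
    rw [lucasW_cast ℂ a b P Q hP hQ]
    push_cast
    rw [aeval_cast, hP, hQ, h3]
    ring
  exact_mod_cast this

theorem aeval_congr (g : MvPolynomial (Fin 2) ℤ) (m : ℕ) (P Q P' Q' : ℤ)
    (hP : (m : ℤ) ∣ P - P') (hQ : (m : ℤ) ∣ Q - Q') :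
    (m : ℤ) ∣ (MvPolynomial.aeval ![P, Q] g : ℤ) - MvPolynomial.aeval ![P', Q'] g := by
  rw [← ZMod.intCast_zmod_eq_zero_iff_dvd] at *
  push_cast at *
  rw [aeval_cast, aeval_cast, sub_eq_zero.1 hP, sub_eq_zero.1 hQ, sub_self]

theorem int_fermat (p : ℕ) (hp : p.Prime) (Q : ℤ) : (p : ℤ) ∣ Q ^ p - Q := by
  haveI := Fact.mk hp
  rw [← ZMod.intCast_zmod_eq_zero_iff_dvd]
  push_cast
  rw [ZMod.pow_card, sub_self]

theorem pow_congr (p : ℕ) (hp : p.Prime) (Q : ℤ) (k : ℕ) :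
    ((p ^ (k + 1) : ℕ) : ℤ) ∣ Q ^ p ^ (k + 1) - Q ^ p ^ k := by
  have := dvd_sub_pow_of_dvd_sub (int_fermat p hp Q) k
  rw [← pow_mul, ← pow_succ'] at this
  exact_mod_cast this

theorem lucasW_congr (P Q : ℤ) (p : ℕ) (hp : p.Prime) (k : ℕ) :
    ((p ^ (k + 1) : ℕ) : ℤ) ∣ lucasW P Q (p ^ (k + 1)) - lucasW P Q (p ^ k) := by
  obtain ⟨g, hg⟩ := lucasW_prime p hp
  induction k with
  | zero =>
    simp only [zero_add, pow_one, pow_zero, hg]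
    have e : P ^ p - p * (MvPolynomial.aeval ![P, Q] g : ℤ) - lucasW P Q 1 =
      (P ^ p - P) - p * (MvPolynomial.aeval ![P, Q] g : ℤ) := by
      simp only [lucasW]; ring
    rw [e]
    exact dvd_sub (int_fermat p hp P) (dvd_mul_right _ _)
  | succ k ih =>
    have e0 : lucasW P Q (p ^ (k + 1)) = lucasW P Q (p ^ k) ^ p -
        p * MvPolynomial.aeval ![lucasW P Q (p ^ k), Q ^ p ^ k] g := by
      rw [pow_succ, ← lucasW_comp, hg]
    have e1 : lucasW P Q (p ^ (k + 1 + 1)) = lucasW P Q (p ^ (k + 1)) ^ p -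
        p * MvPolynomial.aeval ![lucasW P Q (p ^ (k + 1)), Q ^ p ^ (k + 1)] g := by
      rw [pow_succ p (k + 1), ← lucasW_comp, hg]
    have d1 := aeval_congr g _ _ _ _ _ ih (pow_congr p hp Q k)
    generalize lucasW P Q (p ^ (k + 1 + 1)) = z at *
    have d2 : ((p ^ (k + 1 + 1) : ℕ) : ℤ) ∣
        lucasW P Q (p ^ (k + 1)) ^ p - lucasW P Q (p ^ k) ^ p := by
      rw [← geom_sum₂_mul, mul_comm, pow_succ p (k + 1), Nat.cast_mul]
      apply mul_dvd_mul ih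
      apply dvd_geom_sum₂_self
      exact (Int.natCast_dvd_natCast.2 (dvd_pow_self p (by omega))).trans ih
    have d3 := mul_dvd_mul_left (p : ℤ) d1
    rw [← Nat.cast_mul, ← pow_succ'] at d3
    have := dvd_sub d2 d3
    have e2 : z - lucasW P Q (p ^ (k + 1)) =
        lucasW P Q (p ^ (k + 1)) ^ p - lucasW P Q (p ^ k) ^ p - p *
        ((MvPolynomial.aeval ![lucasW P Q (p ^ (k + 1)), Q ^ p ^ (k + 1)] g : ℤ) -
          MvPolynomial.aeval ![lucasW P Q (p ^ k), Q ^ p ^ k] g) := by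
      linear_combination e1 - e0
    rw [e2]
    exact this

theorem cycV_unit_aux (K : Type) [Field K] [IsAlgClosed K] (P Q : ℤ) (p n : ℕ) [CharP K p] (hpn : ¬ p ∣ n) (hn : 1 < n)
    (hpD : (p : ℤ) ∣ P ^ 2 - 4 * Q) (hpQ : ¬ (p : ℤ) ∣ Q) (m : ℕ) :
    ¬ (p : ℤ) ∣ cycV n (lucasW P Q m) (Q ^ m) := by
  obtain ⟨a, b, hP, hQ⟩ := exists_roots K P Q
  rw [← CharP.intCast_eq_zero_iff K p] at *
  have hab : a = b := by
    push_cast at hpD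
    rw [hP, hQ] at hpD
    have : (a - b) ^ 2 = 0 := by linear_combination hpD
    exact sub_eq_zero.1 (pow_eq_zero_iff (by norm_num) |>.1 this)
  subst hab
  have ha : a ≠ 0 := by
    rintro rfl
    apply hpQ
    rw [hQ, mul_zero]
  rw [cycV_cast n hn K (a ^ m) (a ^ m) _ _ (lucasW_cast K a a P Q hP hQ m)
      (by push_cast; rw [hQ, mul_pow]), cycH_eval _ _ _ _ (pow_ne_zero _ ha),
      div_self (pow_ne_zero _ ha)]
  apply mul_ne_zero (pow_ne_zero _ (pow_ne_zero _ ha))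
  intro h
  haveI : NeZero (n : K) := ⟨by
    intro h0
    exact hpn ((CharP.cast_eq_zero_iff K p n).1 h0)⟩
  have h1 := (Polynomial.isRoot_cyclotomic_iff (R := K) (n := n) (μ := 1)).1 h
  have := h1.unique IsPrimitiveRoot.one
  omega

theorem cycV_unit (P Q : ℤ) (p n : ℕ) (hp : p.Prime) (hpn : ¬ p ∣ n) (hn : 1 < n)
    (hpD : (p : ℤ) ∣ P ^ 2 - 4 * Q) (hpQ : ¬ (p : ℤ) ∣ Q) (m : ℕ) :
    ¬ (p : ℤ) ∣ cycV n (lucasW P Q m) (Q ^ m) := by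
  have := Fact.mk hp
  exact cycV_unit_aux (AlgebraicClosure (ZMod p)) P Q p n hpn hn hpD hpQ m

theorem not_dvd_Q (P Q : ℤ) (p : ℕ) (hp : p.Prime) (hpD : (p : ℤ) ∣ (P ^ 2 - 4 * Q))
    (hpPQ : ¬ p ∣ Int.gcd P Q) : ¬ (p : ℤ) ∣ Q := by
  intro h
  apply hpPQ
  have h2 : (p : ℤ) ∣ P ^ 2 := by
    have := dvd_add hpD (h.mul_left 4)
    simpa using this
  have h3 : (p : ℤ) ∣ P := (Nat.prime_iff_prime_int.1 hp).dvd_of_dvd_pow h2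
  exact Int.natCast_dvd_natCast.1 (Int.dvd_coe_gcd h3 h)

theorem stmt_1 (P Q : ℤ) (hP : P ≠ 0) (hQ : Q ≠ 0) (hD : P ^ 2 - 4 * Q ≠ 0)
    (hnd : ∀ m : ℕ, 1 ≤ m → lucasU P Q m ≠ 0)
    (p : ℕ) (hp : p.Prime) (hpD : (p : ℤ) ∣ (P ^ 2 - 4 * Q))
    (hpPQ : ¬ p ∣ Int.gcd P Q)
    (n : ℕ) (hn : 1 < n) (hpn : Nat.gcd p n = 1) (k : ℕ) (hk : 1 ≤ k) :
    ∃ t : ℤ, mobiusDualU P Q (p ^ k * n) = 1 + (p : ℚ) ^ k * (t : ℚ) := by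
  have hpn' : ¬ p ∣ n := (Nat.Prime.coprime_iff_not_dvd hp).1 hpn
  have hpQ := not_dvd_Q P Q p hp hpD hpPQ
  obtain ⟨j, rfl⟩ : ∃ j, k = j + 1 := ⟨k - 1, by omega⟩
  have hN : 1 < p ^ (j + 1) * n :=
    lt_of_lt_of_le hn (Nat.le_mul_of_pos_left _ (pow_pos hp.pos _))
  rw [mobiusDualU_eq P Q hD hnd _ hN]
  have hA := cycV_tower P Q hQ p n hp hpn' hn j
  have hB := cycV_unit P Q p n hp hpn' hn hpD hpQ (p ^ j)
  have hC := aeval_congr (cycG n) _ _ _ _ _ (lucasW_congr P Q p hp j) (pow_congr p hp Q j)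
  change _ ∣ cycV n _ _ - cycV n _ _ at hC
  rw [← hA] at hC
  have hcop : IsCoprime ((p ^ (j + 1) : ℕ) : ℤ) (cycV n (lucasW P Q (p ^ j)) (Q ^ p ^ j)) := by
    push_cast
    exact IsCoprime.pow_left (((Nat.prime_iff_prime_int.1 hp).coprime_iff_not_dvd).2 hB)
  obtain ⟨t, ht⟩ : ((p ^ (j + 1) : ℕ) : ℤ) ∣ cycV (p ^ (j + 1) * n) P Q - 1 := by
    apply hcop.dvd_of_dvd_mul_right
    rw [sub_mul, one_mul]
    exact hC
  refine ⟨t, ?_⟩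
  have h := sub_eq_iff_eq_add'.1 ht
  rw [h]
  push_cast
  ring
end

section
/- Let P and Q be nonzero integers with D = P^2 - 4Q ≠ 0, let U = U(P,Q) be nondegenerate, and let p be an odd prime with p ∤ D and p ∤ gcd(P,Q). Let n be the entry point of p in U (i.e. p ∣ U_n and p ∤ U_m for all 1 ≤ m < n) and assume gcd(p,n) = 1. Then for every integer k ≥ 1 there exists an integer t such that M^U_{p^k n} = (D/p)·p + p^{k+1}·t, where (D/p) is the Legendre symbol. -/
lemma aux_binet (P Q : ℤ) (a b : ℂ) (hs : a + b = P) (hq : a * b = Q) (m : ℕ) :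
    (a - b) * (lucasU P Q m : ℂ) = a ^ m - b ^ m := by
  induction m using Nat.twoStepInduction with
  | zero => simp [lucasU]
  | one => simp [lucasU]
  | more n h1 h2 =>
    simp only [lucasU]
    push_cast
    rw [← hs, ← hq]
    linear_combination (a + b) * h2 - a * b * h1

lemma aux_integral (P Q : ℤ) (hD : P ^ 2 - 4 * Q ≠ 0)
    (hnd : ∀ m : ℕ, 1 ≤ m → lucasU P Q m ≠ 0) (N : ℕ) (hN : 0 < N) :
    ∃ t : ℤ, mobiusDualU P Q N = t := by
  classical
  obtain ⟨s, hs⟩ : ∃ s : ℂ, s ^ 2 = ((P ^ 2 - 4 * Q : ℤ) : ℂ) := IsAlgClosed.exists_pow_nat_eq _ (by norm_num)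
  push_cast at hs
  set a : ℂ := (P + s) / 2 with ha
  set b : ℂ := (P - s) / 2 with hb
  have hsum : a + b = P := by rw [ha, hb]; ring
  have hprod : a * b = Q := by rw [ha, hb]; linear_combination (-1/4) * hs
  have hab : a - b ≠ 0 := by
    intro h
    have : s = 0 := by rw [ha, hb] at h; linear_combination h
    rw [this] at hs
    apply hD
    have : ((P ^ 2 - 4 * Q : ℤ) : ℂ) = 0 := by push_cast; rw [← hs]; norm_num
    exact_mod_cast this
  have hint : ∀ x : ℂ, x ^ 2 - P * x + Q = 0 → IsIntegral ℤ x := by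
    intro x hx
    refine ⟨Polynomial.X ^ 2 - Polynomial.C P * Polynomial.X + Polynomial.C Q, ?_, ?_⟩
    · monicity!
    · simp only [Polynomial.eval₂_add, Polynomial.eval₂_sub, Polynomial.eval₂_mul,
        Polynomial.eval₂_X_pow, Polynomial.eval₂_C, Polynomial.eval₂_X]
      simpa using hx
  have hai : IsIntegral ℤ a := hint a (by rw [← hsum, ← hprod]; ring)
  have hbi : IsIntegral ℤ b := hint b (by rw [← hsum, ← hprod]; ring)
  let f : ℕ → ℂ := fun m => if m = 1 then 1 else ∏ z ∈ primitiveRoots m ℂ, (a - z * b)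
  have hfi : ∀ m, 0 < m → IsIntegral ℤ (f m) := by
    intro m hm
    simp only [f]
    split_ifs
    · exact isIntegral_one
    · refine IsIntegral.prod _ fun z hz => ?_
      exact hai.sub (((mem_primitiveRoots hm).1 hz).isIntegral hm |>.mul hbi)
  have key : ∀ m > 0, ∏ d ∈ m.divisors, f d = (lucasU P Q m : ℂ) := by
    intro m hm
    have h1 := aux_binet P Q a b hsum hprod m
    have h2 := (Complex.isPrimitiveRoot_exp m hm.ne').pow_sub_pow_eq_prod_sub_mul a b hm
    rw [IsPrimitiveRoot.nthRoots_one_eq_biUnion_primitiveRoots, Finset.prod_biUnion] at h2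
    · rw [← Finset.mul_prod_erase _ _ (Nat.one_mem_divisors.2 hm.ne')] at h2 ⊢
      rw [h2] at h1
      simp only [IsPrimitiveRoot.primitiveRoots_one, Finset.prod_singleton, one_mul] at h1
      have h3 := mul_left_cancel₀ hab h1
      rw [h3]
      simp only [f, if_true, one_mul]
      refine Finset.prod_congr rfl fun d hd => ?_
      rw [if_neg (Finset.ne_of_mem_erase hd)]
    · intro i hi j hj hij
      exact IsPrimitiveRoot.disjoint hij
  have hg0 : ∀ m : ℕ, 0 < m → (lucasU P Q m : ℂ) ≠ 0 := fun m hm => by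
    exact_mod_cast hnd m hm
  have hf0 : ∀ m : ℕ, 0 < m → f m ≠ 0 := by
    intro m hm h
    apply hg0 m hm
    rw [← key m hm]
    exact Finset.prod_eq_zero (Nat.mem_divisors_self m hm.ne') h
  have h := (ArithmeticFunction.prod_eq_iff_prod_pow_moebius_eq_of_nonzero hf0 hg0).1 key N hN
  have hM : ((mobiusDualU P Q N : ℚ) : ℂ) = f N := by
    rw [← h, mobiusDualU]
    rw [Nat.prod_divisorsAntidiagonal' (fun i j => (lucasU P Q j : ℂ) ^ ArithmeticFunction.moebius i)]
    push_cast
    rfl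
  have hI : IsIntegral ℤ ((mobiusDualU P Q N : ℚ) : ℂ) := hM ▸ hfi N hN
  have hI' : IsIntegral ℤ (mobiusDualU P Q N) := by
    rw [← isIntegral_algebraMap_iff (A := ℚ) (B := ℂ) (algebraMap ℚ ℂ).injective]
    simpa using hI
  obtain ⟨t, ht⟩ := IsIntegrallyClosed.isIntegral_iff.1 hI'
  exact ⟨t, by simpa using ht.symm⟩

lemma aux_split (P Q : ℤ) (p : ℕ) (hp : p.Prime) (n : ℕ) (hn : 1 ≤ n) (hpn : Nat.gcd p n = 1)
    (k : ℕ) : mobiusDualU P Q (p ^ (k + 1) * n) =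
      ∏ d ∈ n.divisors, ((lucasU P Q (p ^ (k + 1) * d) : ℚ) / (lucasU P Q (p ^ k * d) : ℚ)) ^
        (ArithmeticFunction.moebius (n / d)) := by
  have hc : (p ^ (k + 1)).Coprime n := Nat.Coprime.pow_left _ hpn
  have hp0 := hp.pos
  rw [mobiusDualU, Nat.divisors_mul, Finset.mul_def, Finset.prod_image hc.mul_injOn_divisors,
    Finset.prod_product_right]
  refine Finset.prod_congr rfl fun d hd => ?_
  have hdn := Nat.dvd_of_mem_divisors hd
  have hdpos : 0 < d := Nat.pos_of_mem_divisors hd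
  rw [Nat.prod_divisors_prime_pow hp]
  have hmu : ∀ i ≤ k + 1, ArithmeticFunction.moebius (p ^ (k + 1) * n / (p ^ i * d)) =
      ArithmeticFunction.moebius (p ^ (k + 1 - i)) * ArithmeticFunction.moebius (n / d) := by
    intro i hi
    rw [Nat.mul_div_mul_comm (pow_dvd_pow p hi) hdn, Nat.pow_div hi hp0]
    apply ArithmeticFunction.isMultiplicative_moebius.map_mul_of_coprime
    exact Nat.Coprime.pow_left _ (Nat.Coprime.coprime_dvd_right (Nat.div_dvd_of_dvd hdn) hpn)
  rw [Finset.prod_range_succ, Finset.prod_range_succ, Finset.prod_eq_one, hmu _ le_rfl,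
    hmu k (Nat.le_succ k)]
  · simp [ArithmeticFunction.moebius_apply_prime hp, div_zpow, div_eq_mul_inv, mul_comm, mul_zpow]
  · intro i hi
    have hi := Finset.mem_range.1 hi
    rw [hmu i (by omega), ArithmeticFunction.moebius_apply_prime_pow hp (by omega),
      if_neg (by omega)]
    simp

/-- Rationals that are `p`-adic units congruent to `1` modulo `p ^ k`. -/
def NearOne (p k : ℕ) (x : ℚ) : Prop :=
  ∃ u v : ℤ, ¬ (p : ℤ) ∣ u ∧ ¬ (p : ℤ) ∣ v ∧ (p : ℤ) ^ k ∣ u - v ∧ x = u / v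

lemma NearOne.one {p k : ℕ} (hp : p.Prime) : NearOne p k 1 :=
  ⟨1, 1, (Nat.prime_iff_prime_int.1 hp).not_dvd_one, (Nat.prime_iff_prime_int.1 hp).not_dvd_one,
    by simp, by simp⟩

lemma NearOne.mul {p k : ℕ} (hp : p.Prime) {x y : ℚ} (hx : NearOne p k x) (hy : NearOne p k y) :
    NearOne p k (x * y) := by
  obtain ⟨u, v, hu, hv, h, rfl⟩ := hx
  obtain ⟨u', v', hu', hv', h', rfl⟩ := hy
  have hp' := Nat.prime_iff_prime_int.1 hp
  refine ⟨u * u', v * v', fun h => (hp'.dvd_or_dvd h).elim hu hu',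
    fun h => (hp'.dvd_or_dvd h).elim hv hv', ?_, ?_⟩
  · have : u * u' - v * v' = (u - v) * u' + v * (u' - v') := by ring
    rw [this]
    exact dvd_add (h.mul_right _) (h'.mul_left _)
  · push_cast
    rw [div_mul_div_comm]

lemma NearOne.inv {p k : ℕ} {x : ℚ} (hx : NearOne p k x) : NearOne p k x⁻¹ := by
  obtain ⟨u, v, hu, hv, h, rfl⟩ := hx
  exact ⟨v, u, hv, hu, by rw [← neg_sub]; exact h.neg_right, by rw [inv_div]⟩

lemma NearOne.moebius {p k : ℕ} (hp : p.Prime) {x : ℚ} (hx : NearOne p k x) (m : ℕ) :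
    NearOne p k (x ^ (ArithmeticFunction.moebius m)) := by
  rcases ArithmeticFunction.moebius_eq_or m with h | h | h <;> rw [h]
  · simpa using NearOne.one hp
  · simpa using hx
  · simpa using hx.inv

lemma aux_sum_moebius (n : ℕ) (hn : 1 < n) :
    ∑ d ∈ n.divisors.erase n, ArithmeticFunction.moebius (n / d) = -1 := by
  have h1 : ∑ d ∈ n.divisors, ArithmeticFunction.moebius (n / d) = 0 := by
    rw [Nat.sum_div_divisors n (fun d => ArithmeticFunction.moebius d),
      ← ArithmeticFunction.coe_mul_zeta_apply, ArithmeticFunction.moebius_mul_coe_zeta]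
    simp [hn.ne']
  rw [← Finset.add_sum_erase _ _ (Nat.mem_divisors_self n (by omega)), Nat.div_self (by omega)] at h1
  simp at h1
  linarith

lemma aux_final (P Q : ℤ) (p : ℕ) (hp : p.Prime) (e : ℤ) (he : e * e = 1) (n : ℕ) (hn : 1 < n)
    (hpn : Nat.gcd p n = 1) (k : ℕ) (M : ℤ) (hM : mobiusDualU P Q (p ^ (k + 1) * n) = M)
    (h1 : ∀ d, d ∣ n → d < n → NearOne p (k + 1)
      (e * ((lucasU P Q (p ^ (k + 1) * d) : ℚ) / (lucasU P Q (p ^ k * d) : ℚ))))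
    (h2 : ∃ w, NearOne p (k + 1) w ∧
      ((lucasU P Q (p ^ (k + 1) * n) : ℚ) / (lucasU P Q (p ^ k * n) : ℚ)) = p * w) :
    ∃ t : ℤ, mobiusDualU P Q (p ^ (k + 1) * n) = e * (p : ℚ) + (p : ℚ) ^ (k + 1 + 1) * (t : ℚ) := by
  have hp' := Nat.prime_iff_prime_int.1 hp
  have heq : (e : ℚ) * e = 1 := by exact_mod_cast he
  have he0 : (e : ℚ) ≠ 0 := left_ne_zero_of_mul_eq_one heq
  obtain ⟨w, hw, hw2⟩ := h2
  have hs := aux_split P Q p hp n hn.le hpn k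
  rw [← Finset.mul_prod_erase _ _ (Nat.mem_divisors_self n (by omega)), hw2,
    Nat.div_self (by omega), ArithmeticFunction.moebius_apply_one, zpow_one] at hs
  have hN : NearOne p (k + 1) (∏ d ∈ n.divisors.erase n,
      (e * ((lucasU P Q (p ^ (k + 1) * d) : ℚ) / (lucasU P Q (p ^ k * d) : ℚ))) ^
        (ArithmeticFunction.moebius (n / d))) := by
    refine Finset.prod_induction _ (NearOne p (k + 1)) (fun a b ha hb => ha.mul hp hb)
      (NearOne.one hp) fun d hd => ?_
    obtain ⟨hdn, hd⟩ := Finset.mem_erase.1 hd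
    have hd := Nat.dvd_of_mem_divisors hd
    exact (h1 d hd (lt_of_le_of_ne (Nat.le_of_dvd (by omega) hd) hdn)).moebius hp _
  simp only [mul_zpow] at hN
  rw [Finset.prod_mul_distrib] at hN
  have hE : ∏ d ∈ n.divisors.erase n, (e : ℚ) ^ (ArithmeticFunction.moebius (n / d)) = e := by
    have hz : ∀ s : Finset ℕ, ∏ d ∈ s, (e : ℚ) ^ (ArithmeticFunction.moebius (n / d)) =
        (e : ℚ) ^ (∑ d ∈ s, ArithmeticFunction.moebius (n / d)) := by
      intro s
      induction s using Finset.induction_on with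
      | empty => simp
      | insert a s ha ih => rw [Finset.prod_insert ha, Finset.sum_insert ha, zpow_add₀ he0, ih]
    rw [hz, aux_sum_moebius n hn, zpow_neg_one]
    exact inv_eq_of_mul_eq_one_left heq
  rw [hE] at hN
  obtain ⟨u, v, hu, hv, huv, hx⟩ := hN.mul hp hw
  set R := ∏ x ∈ n.divisors.erase n, ((lucasU P Q (p ^ (k + 1) * x) : ℚ) /
    (lucasU P Q (p ^ k * x) : ℚ)) ^ (ArithmeticFunction.moebius (n / x)) with hR
  have hv0 : (v : ℚ) ≠ 0 := by
    intro h
    apply hv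
    have : v = 0 := by exact_mod_cast h
    simp [this]
  have hMq : (M : ℚ) * v = e * p * u := by
    rw [eq_div_iff hv0] at hx
    rw [← hM, hs, ← hx]
    linear_combination -(p * w * R * v) * heq
  have hMz : M * v = e * p * u := by exact_mod_cast hMq
  have hpM : (p : ℤ) ∣ M :=
    (hp'.dvd_or_dvd (⟨e * u, by rw [hMz]; ring⟩ : (p : ℤ) ∣ M * v)).resolve_right hv
  obtain ⟨M', rfl⟩ := hpM
  have hM' : M' * v = e * u := by
    apply mul_left_cancel₀ hp'.ne_zero
    linear_combination hMz
  have hd : (p : ℤ) ^ (k + 1) ∣ v * (M' - e) := by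
    have : v * (M' - e) = e * (u - v) := by linear_combination hM'
    rw [this]
    exact huv.mul_left _
  have hcop : IsCoprime ((p : ℤ) ^ (k + 1)) v :=
    ((Prime.coprime_iff_not_dvd hp').2 hv).pow_left
  obtain ⟨t, ht⟩ := hcop.dvd_of_dvd_mul_left hd
  refine ⟨t, ?_⟩
  have : M' = e + p ^ (k + 1) * t := by linear_combination ht
  rw [hM, this]
  push_cast
  ring

lemma aux_dvd {a b c : ℤ} (h : a ∣ b) (e : c = b) : a ∣ c := e ▸ h

lemma aux_gam (P Q : ℤ) (m : ℕ) :
    2 * ((⟨P, 1⟩ : ℤ√(P ^ 2 - 4 * Q)) ^ m).im = 2 ^ m * lucasU P Q m := by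
  induction m using Nat.twoStepInduction with
  | zero => simp [lucasU]
  | one => simp [lucasU]
  | more n h1 h2 =>
    have h : (⟨P, 1⟩ : ℤ√(P ^ 2 - 4 * Q)) ^ (n + 2) =
      ((2 * P : ℤ) : ℤ√(P ^ 2 - 4 * Q)) * (⟨P, 1⟩ : ℤ√(P ^ 2 - 4 * Q)) ^ (n + 1)
        - ((4 * Q : ℤ) : ℤ√(P ^ 2 - 4 * Q)) * (⟨P, 1⟩ : ℤ√(P ^ 2 - 4 * Q)) ^ n := by
      have h0 : (⟨P, 1⟩ : ℤ√(P ^ 2 - 4 * Q)) ^ 2 = ((2 * P : ℤ) : ℤ√(P ^ 2 - 4 * Q)) *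
          (⟨P, 1⟩ : ℤ√(P ^ 2 - 4 * Q)) - ((4 * Q : ℤ) : ℤ√(P ^ 2 - 4 * Q)) := by
        rw [sq (⟨P, 1⟩ : ℤ√(P ^ 2 - 4 * Q))]
        apply Zsqrtd.ext
        · simp only [Zsqrtd.re_mul, Zsqrtd.re_sub, Zsqrtd.re_intCast, Zsqrtd.im_intCast]; ring
        · simp only [Zsqrtd.im_mul, Zsqrtd.im_sub, Zsqrtd.re_intCast, Zsqrtd.im_intCast]; ring
      rw [pow_add, h0]
      ring
    rw [h]
    simp only [Zsqrtd.im_sub, Zsqrtd.im_mul, Zsqrtd.re_intCast, Zsqrtd.im_intCast, lucasU]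
    linear_combination (2 * P) * h2 - 4 * Q * h1

lemma aux_conj (D P e : ℤ) (he : e * e = 1) (m : ℕ) :
    ((⟨P, e⟩ : ℤ√D) ^ m).re = ((⟨P, 1⟩ : ℤ√D) ^ m).re ∧
    ((⟨P, e⟩ : ℤ√D) ^ m).im = e * ((⟨P, 1⟩ : ℤ√D) ^ m).im := by
  induction m with
  | zero => simp
  | succ m ih =>
    rw [pow_succ, pow_succ]
    simp only [Zsqrtd.re_mul, Zsqrtd.im_mul, ih.1, ih.2]
    constructor
    · linear_combination (D * ((⟨P, 1⟩ : ℤ√D) ^ m).im) * he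
    · ring

lemma aux_frob (D P : ℤ) (p : ℕ) (hp : p.Prime) (hodd : Odd p) :
    (p : ℤ√D) ∣ (⟨P, 1⟩ : ℤ√D) ^ p - ⟨P, jacobiSym D p⟩ := by
  have : Fact p.Prime := ⟨hp⟩
  obtain ⟨r, hr⟩ := exists_add_pow_prime_eq hp (P : ℤ√D) Zsqrtd.sqrtd
  have h0 : (⟨P, 1⟩ : ℤ√D) = (P : ℤ√D) + Zsqrtd.sqrtd := by
    apply Zsqrtd.ext <;> simp
  have h1 : (⟨P, jacobiSym D p⟩ : ℤ√D) = (P : ℤ√D) + ((jacobiSym D p : ℤ) : ℤ√D) * Zsqrtd.sqrtd := by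
    apply Zsqrtd.ext <;> simp
  have h2 : (Zsqrtd.sqrtd : ℤ√D) ^ p = ((D ^ (p / 2) : ℤ) : ℤ√D) * Zsqrtd.sqrtd := by
    conv_lhs => rw [← Nat.two_mul_div_two_add_one_of_odd hodd, pow_succ, pow_mul, sq,
      Zsqrtd.dmuld]
    push_cast
    rfl
  have h3 : (p : ℤ) ∣ P ^ p - P := by
    rw [← ZMod.intCast_zmod_eq_zero_iff_dvd]
    push_cast
    rw [ZMod.pow_card, sub_self]
  have h4 : (p : ℤ) ∣ D ^ (p / 2) - jacobiSym D p := by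
    rw [← ZMod.intCast_zmod_eq_zero_iff_dvd]
    push_cast
    rw [← jacobiSym.legendreSym.to_jacobiSym, legendreSym.eq_pow, sub_self]
  obtain ⟨s, hs⟩ := h3
  obtain ⟨t, ht⟩ := h4
  have hs' : (P : ℤ√D) ^ p - P = p * s := by exact_mod_cast congrArg (Int.cast : ℤ → ℤ√D) hs
  have ht' : ((D ^ (p / 2) : ℤ) : ℤ√D) - ((jacobiSym D p : ℤ) : ℤ√D) = p * t := by
    exact_mod_cast congrArg (Int.cast : ℤ → ℤ√D) ht
  rw [h0, h1, hr, h2]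
  refine ⟨(s : ℤ√D) + (t : ℤ√D) * Zsqrtd.sqrtd + (P : ℤ√D) * Zsqrtd.sqrtd * r, ?_⟩
  linear_combination hs' + Zsqrtd.sqrtd * ht'

lemma aux_lift (D P : ℤ) (p : ℕ) (hp : p.Prime) (hodd : Odd p)
    (he : jacobiSym D p * jacobiSym D p = 1) (j d : ℕ) :
    (p : ℤ) ^ (j + 1) ∣ ((⟨P, 1⟩ : ℤ√D) ^ (p ^ (j + 1) * d)).re -
        ((⟨P, 1⟩ : ℤ√D) ^ (p ^ j * d)).re ∧
    (p : ℤ) ^ (j + 1) ∣ ((⟨P, 1⟩ : ℤ√D) ^ (p ^ (j + 1) * d)).im -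
        jacobiSym D p * ((⟨P, 1⟩ : ℤ√D) ^ (p ^ j * d)).im := by
  have h := dvd_sub_pow_of_dvd_sub (aux_frob D P p hp hodd) j
  have h' := h.trans (sub_dvd_pow_sub_pow _ _ d)
  rw [← pow_mul, ← pow_mul, ← pow_mul, ← mul_assoc, ← pow_succ'] at h'
  have h'' : (((p : ℤ) ^ (j + 1) : ℤ) : ℤ√D) ∣ (⟨P, 1⟩ : ℤ√D) ^ (p ^ (j + 1) * d) -
    (⟨P, jacobiSym D p⟩ : ℤ√D) ^ (p ^ j * d) := by exact_mod_cast h'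
  rw [Zsqrtd.intCast_dvd, Zsqrtd.re_sub, Zsqrtd.im_sub, (aux_conj D P _ he _).1,
    (aux_conj D P _ he _).2] at h''
  exact h''

lemma aux_two (p : ℕ) (hp : p.Prime) (j d : ℕ) :
    (p : ℤ) ^ (j + 1) ∣ 2 ^ (p ^ (j + 1) * d) - 2 ^ (p ^ j * d) := by
  have : Fact p.Prime := ⟨hp⟩
  have h3 : (p : ℤ) ∣ 2 ^ p - 2 := by
    rw [← ZMod.intCast_zmod_eq_zero_iff_dvd]
    push_cast
    rw [ZMod.pow_card, sub_self]
  have h' := (dvd_sub_pow_of_dvd_sub h3 j).trans (sub_dvd_pow_sub_pow _ _ d)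
  rw [← pow_mul, ← pow_mul, ← pow_mul, ← mul_assoc, ← pow_succ'] at h'
  exact_mod_cast h'

lemma aux_not_dvd_two_pow (p : ℕ) (hp : p.Prime) (hodd : Odd p) (m : ℕ) :
    ¬ (p : ℤ) ∣ 2 ^ m := by
  intro h
  have h1 := (Nat.prime_iff_prime_int.1 hp).dvd_of_dvd_pow h
  have h2 : p ∣ 2 := by exact_mod_cast h1
  have h3 := (Nat.prime_dvd_prime_iff_eq hp Nat.prime_two).1 h2
  subst h3
  exact absurd hodd (by decide)

lemma aux_U (P Q : ℤ) (p : ℕ) (hp : p.Prime) (hodd : Odd p)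
    (he : jacobiSym (P ^ 2 - 4 * Q) p * jacobiSym (P ^ 2 - 4 * Q) p = 1) (j d : ℕ) :
    (p : ℤ) ^ (j + 1) ∣ lucasU P Q (p ^ (j + 1) * d) -
        jacobiSym (P ^ 2 - 4 * Q) p * lucasU P Q (p ^ j * d) := by
  have h := (aux_lift _ P p hp hodd he j d).2
  have g1 := aux_gam P Q (p ^ (j + 1) * d)
  have g2 := aux_gam P Q (p ^ j * d)
  have h2 := aux_two p hp j d
  set e := jacobiSym (P ^ 2 - 4 * Q) p
  set A : ℤ := 2 ^ (p ^ (j + 1) * d)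
  set B : ℤ := 2 ^ (p ^ j * d) with hB
  have hcop : IsCoprime ((p : ℤ) ^ (j + 1)) B :=
    ((Prime.coprime_iff_not_dvd (Nat.prime_iff_prime_int.1 hp)).2
      (aux_not_dvd_two_pow p hp hodd _)).pow_left
  apply hcop.dvd_of_dvd_mul_left
  have := dvd_sub (h.mul_left 2) (h2.mul_right (lucasU P Q (p ^ (j + 1) * d)))
  refine aux_dvd this ?_
  linear_combination -g1 + e * g2

lemma aux_U_unit (P Q : ℤ) (p : ℕ) (hp : p.Prime) (hodd : Odd p)
    (he : jacobiSym (P ^ 2 - 4 * Q) p * jacobiSym (P ^ 2 - 4 * Q) p = 1) (d : ℕ)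
    (hd : ¬ (p : ℤ) ∣ lucasU P Q d) (j : ℕ) : ¬ (p : ℤ) ∣ lucasU P Q (p ^ j * d) := by
  induction j with
  | zero => simpa using hd
  | succ j ih =>
    intro h
    apply ih
    have h1 := (dvd_pow_self (p : ℤ) (Nat.succ_ne_zero j)).trans (aux_U P Q p hp hodd he j d)
    have h2 := (dvd_sub h h1).mul_left (jacobiSym (P ^ 2 - 4 * Q) p)
    refine aux_dvd h2 ?_
    linear_combination -(lucasU P Q (p ^ j * d)) * he

lemma aux_pow_expand (D : ℤ) (g : ℤ√D) (m : ℕ) :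
    ∃ s t : ℤ, (g ^ (m + 1)).re = g.re ^ (m + 1) + g.im ^ 2 * t ∧
      (g ^ (m + 1)).im = g.im * ((m + 1) * g.re ^ m + g.im ^ 2 * s) := by
  induction m with
  | zero => exact ⟨0, 0, by simp, by simp⟩
  | succ m ih =>
    obtain ⟨s, t, h1, h2⟩ := ih
    refine ⟨t + s * g.re, g.re * t + D * ((m + 1) * g.re ^ m + g.im ^ 2 * s), ?_, ?_⟩
    · rw [pow_succ, Zsqrtd.re_mul, h1, h2]; ring
    · rw [pow_succ, Zsqrtd.im_mul, h1, h2]; push_cast; ring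

lemma aux_Q (P Q : ℤ) (p : ℕ) (hp : p.Prime) (hpPQ : ¬ p ∣ Int.gcd P Q) (n : ℕ) (hn : 1 ≤ n)
    (hz : (p : ℤ) ∣ lucasU P Q n) : ¬ (p : ℤ) ∣ Q := by
  intro hQ
  have hp' := Nat.prime_iff_prime_int.1 hp
  have hP : ¬ (p : ℤ) ∣ P := fun h => hpPQ (by
    have := Int.dvd_coe_gcd h hQ
    exact_mod_cast this)
  have : ∀ m, ¬ (p : ℤ) ∣ lucasU P Q (m + 1) := by
    intro m
    induction m with
    | zero => simpa [lucasU] using hp'.not_dvd_one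
    | succ m ih =>
      intro h
      rw [lucasU] at h
      have := dvd_add h (hQ.mul_right (lucasU P Q m))
      rw [sub_add_cancel] at this
      exact (hp'.dvd_or_dvd this).elim hP ih
  obtain ⟨m, rfl⟩ : ∃ m, n = m + 1 := ⟨n - 1, by omega⟩
  exact this m hz

lemma aux_top (P Q : ℤ) (hnd : ∀ m : ℕ, 1 ≤ m → lucasU P Q m ≠ 0)
    (p : ℕ) (hp : p.Prime) (hodd : Odd p)
    (he : jacobiSym (P ^ 2 - 4 * Q) p * jacobiSym (P ^ 2 - 4 * Q) p = 1)
    (hQ : ¬ (p : ℤ) ∣ Q) (n : ℕ) (hn : 1 ≤ n) (hz : (p : ℤ) ∣ lucasU P Q n) (k : ℕ) :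
    ∃ w, NearOne p (k + 1) w ∧
      ((lucasU P Q (p ^ (k + 1) * n) : ℚ) / (lucasU P Q (p ^ k * n) : ℚ)) = p * w := by
  have hp' := Nat.prime_iff_prime_int.1 hp
  have h2p := aux_not_dvd_two_pow p hp hodd
  have hlift := (aux_lift _ P p hp hodd he k n).1
  have htwo := aux_two p hp k n
  have gn := aux_gam P Q n
  have g1 := aux_gam P Q (p ^ (k + 1) * n)
  have g2 := aux_gam P Q (p ^ k * n)
  set D := P ^ 2 - 4 * Q with hD
  set γ : ℤ√D := ⟨P, 1⟩ with hγ
  set g := γ ^ (p ^ k * n) with hg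
  have hgp : γ ^ (p ^ (k + 1) * n) = g ^ p := by
    rw [hg, ← pow_mul]; congr 1; ring
  rw [hgp] at g1 hlift
  -- `p ^ (k+1)` divides the imaginary part of `g`
  have hxn : (p : ℤ) ∣ (γ ^ n).im := by
    have h : (p : ℤ) ∣ 2 * (γ ^ n).im := by rw [gn]; exact hz.mul_left _
    exact (hp'.dvd_or_dvd h).resolve_left (by simpa using h2p 1)
  have hx : (p : ℤ) ^ (k + 1) ∣ g.im := by
    have h : (p : ℤ√D) ∣ γ ^ n - ((γ ^ n).re : ℤ√D) := by
      have : ((p : ℤ) : ℤ√D) ∣ γ ^ n - ((γ ^ n).re : ℤ√D) := by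
        rw [Zsqrtd.intCast_dvd]
        simpa using hxn
      exact_mod_cast this
    have h' := dvd_sub_pow_of_dvd_sub h k
    have h'' : (((p : ℤ) ^ (k + 1) : ℤ) : ℤ√D) ∣ g - (((γ ^ n).re ^ p ^ k : ℤ) : ℤ√D) := by
      rw [hg, mul_comm, pow_mul]
      exact_mod_cast h'
    rw [Zsqrtd.intCast_dvd] at h''
    have h3 := h''.2
    rwa [Zsqrtd.im_sub, Zsqrtd.im_intCast, sub_zero] at h3
  have hnorm : g.re * g.re - D * g.im * g.im = (4 * Q) ^ (p ^ k * n) := by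
    have : Zsqrtd.norm g = (Zsqrtd.norm γ) ^ (p ^ k * n) := by
      rw [hg]; exact map_pow Zsqrtd.normMonoidHom γ _
    rw [Zsqrtd.norm_def, Zsqrtd.norm_def] at this
    rw [this]
    congr 1
    simp only [hγ, hD]; ring
  have hpx : (p : ℤ) ∣ g.im := (dvd_pow_self (p : ℤ) (Nat.succ_ne_zero k)).trans hx
  have ha : ¬ (p : ℤ) ∣ g.re := by
    intro h
    have h3 : (p : ℤ) ∣ (4 * Q) ^ (p ^ k * n) := by
      rw [← hnorm]
      exact dvd_sub (h.mul_right _) (hpx.mul_left _)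
    rcases hp'.dvd_or_dvd (hp'.dvd_of_dvd_pow h3) with h4 | h4
    · exact h2p 2 (by simpa using h4)
    · exact hQ h4
  obtain ⟨m, hm⟩ : ∃ m, p = m + 1 := ⟨p - 1, by have := hp.pos; omega⟩
  obtain ⟨s, t, e1, e2⟩ := aux_pow_expand D g m
  rw [← hm] at e1 e2
  have hmp : ((m : ℤ) + 1) = p := by rw [hm]; push_cast; ring
  rw [hmp] at e2
  obtain ⟨y, hy⟩ := hx
  have ham : (p : ℤ) ^ (k + 1) ∣ g.re ^ m - 1 := by
    have hcop : IsCoprime ((p : ℤ) ^ (k + 1)) g.re :=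
      ((Prime.coprime_iff_not_dvd hp').2 ha).pow_left
    apply hcop.dvd_of_dvd_mul_left
    have h5 : g.re * (g.re ^ m - 1) = ((g ^ p).re - g.re) - p ^ (k + 1) * (y * g.im * t) := by
      rw [e1]
      have : g.re ^ p = g.re ^ m * g.re := by rw [hm, pow_succ]
      rw [this]
      have : g.im ^ 2 = p ^ (k + 1) * y * g.im := by rw [sq, ← hy]
      rw [this]
      ring
    rw [h5]
    exact dvd_sub hlift (dvd_mul_right _ _)
  have hpk : p ^ (k + 1) * n = p ^ k * n + p ^ k * n * m := by
    have : p ^ (k + 1) = p ^ k * (m + 1) := by rw [← hm, pow_succ]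
    rw [this]; ring
  have hT : (p : ℤ) ^ (k + 1) ∣ 2 ^ (p ^ k * n * m) - 1 := by
    have hcop : IsCoprime ((p : ℤ) ^ (k + 1)) (2 ^ (p ^ k * n)) :=
      ((Prime.coprime_iff_not_dvd hp').2 (h2p _)).pow_left
    apply hcop.dvd_of_dvd_mul_left
    refine aux_dvd htwo ?_
    rw [hpk, pow_add]; ring
  have hu : (p : ℤ) ^ (k + 1) ∣ (g.re ^ m + p ^ (k + 1) * (p ^ k * y ^ 2 * s)) -
      2 ^ (p ^ k * n * m) := by
    have := dvd_add (dvd_sub ham hT) (dvd_mul_right ((p : ℤ) ^ (k + 1)) (p ^ k * y ^ 2 * s))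
    refine aux_dvd this ?_
    ring
  have hUpos : (lucasU P Q (p ^ k * n) : ℚ) ≠ 0 := by
    have := hnd (p ^ k * n) (Nat.mul_pos (pow_pos hp.pos k) hn)
    exact_mod_cast this
  refine ⟨_, ⟨g.re ^ m + p ^ (k + 1) * (p ^ k * y ^ 2 * s), 2 ^ (p ^ k * n * m), ?_, h2p _, hu,
    rfl⟩, ?_⟩
  · intro h
    apply ha
    apply hp'.dvd_of_dvd_pow (n := m)
    have h6 : (p : ℤ) ∣ p ^ (k + 1) * (p ^ k * y ^ 2 * s) :=
      (dvd_pow_self (p : ℤ) (Nat.succ_ne_zero k)).mul_right _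
    have := dvd_sub h h6
    rwa [add_sub_cancel_right] at this
  · have hmain : 2 ^ (p ^ k * n * m) * lucasU P Q (p ^ (k + 1) * n) =
        p * (g.re ^ m + p ^ (k + 1) * (p ^ k * y ^ 2 * s)) * lucasU P Q (p ^ k * n) := by
      have h20 : (2 : ℤ) ^ (p ^ k * n) ≠ 0 := by positivity
      apply mul_left_cancel₀ h20
      have : (2 : ℤ) ^ (p ^ (k + 1) * n) = 2 ^ (p ^ k * n) * 2 ^ (p ^ k * n * m) := by
        rw [hpk, pow_add]
      rw [this, e2] at g1
      have h7 : g.im ^ 2 * s = p * (p ^ (k + 1) * (p ^ k * y ^ 2 * s)) := by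
        rw [hy]; ring
      rw [h7] at g1
      linear_combination -g1 + p * (g.re ^ m + p ^ (k + 1) * (p ^ k * y ^ 2 * s)) * g2
    have hmq : (2 : ℚ) ^ (p ^ k * n * m) * lucasU P Q (p ^ (k + 1) * n) =
        p * (g.re ^ m + p ^ (k + 1) * (p ^ k * y ^ 2 * s)) * lucasU P Q (p ^ k * n) := by
      exact_mod_cast hmain
    push_cast
    rw [mul_div_assoc', div_eq_div_iff hUpos (by positivity)]
    linear_combination hmq

theorem stmt_5 (P Q : ℤ) (hP : P ≠ 0) (hQ : Q ≠ 0) (hD : P ^ 2 - 4 * Q ≠ 0)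
    (hnd : ∀ m : ℕ, 1 ≤ m → lucasU P Q m ≠ 0)
    (p : ℕ) (hp : p.Prime) (hodd : Odd p) (hpD : ¬ (p : ℤ) ∣ (P ^ 2 - 4 * Q))
    (hpPQ : ¬ p ∣ Int.gcd P Q)
    (n : ℕ) (hn : 1 ≤ n) (hpn : Nat.gcd p n = 1)
    (hz : (p : ℤ) ∣ lucasU P Q n ∧
      ∀ m : ℕ, 1 ≤ m → m < n → ¬ (p : ℤ) ∣ lucasU P Q m)
    (k : ℕ) (hk : 1 ≤ k) :
    ∃ t : ℤ, mobiusDualU P Q (p ^ k * n)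
      = (jacobiSym (P ^ 2 - 4 * Q) p : ℚ) * (p : ℚ) + (p : ℚ) ^ (k + 1) * (t : ℚ) := by
  obtain ⟨j, rfl⟩ : ∃ j, k = j + 1 := ⟨k - 1, by omega⟩
  have : Fact p.Prime := ⟨hp⟩
  have hp' := Nat.prime_iff_prime_int.1 hp
  have he : jacobiSym (P ^ 2 - 4 * Q) p * jacobiSym (P ^ 2 - 4 * Q) p = 1 := by
    rw [← sq, ← jacobiSym.legendreSym.to_jacobiSym]
    apply legendreSym.sq_one
    rwa [Ne, ZMod.intCast_zmod_eq_zero_iff_dvd]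
  have hn1 : 1 < n := by
    rcases hn.lt_or_eq with h | h
    · exact h
    · exfalso
      have := hz.1
      rw [← h, lucasU] at this
      exact hp'.not_dvd_one this
  obtain ⟨M, hM⟩ := aux_integral P Q hD hnd (p ^ (j + 1) * n)
    (Nat.mul_pos (pow_pos hp.pos _) hn)
  refine aux_final P Q p hp _ he n hn1 hpn j M hM ?_
    (aux_top P Q hnd p hp hodd he (aux_Q P Q p hp hpPQ n hn hz.1) n hn hz.1 j)
  intro d hd hdn
  have hd1 : 1 ≤ d := Nat.pos_of_dvd_of_pos hd hn
  have hunit := aux_U_unit P Q p hp hodd he d (hz.2 d hd1 hdn)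
  have hU := aux_U P Q p hp hodd he j d
  refine ⟨jacobiSym (P ^ 2 - 4 * Q) p * lucasU P Q (p ^ (j + 1) * d), lucasU P Q (p ^ j * d),
    ?_, hunit j, ?_, ?_⟩
  · intro h
    apply hunit (j + 1)
    have := h.mul_left (jacobiSym (P ^ 2 - 4 * Q) p)
    rwa [← mul_assoc, he, one_mul] at this
  · have := hU.mul_left (jacobiSym (P ^ 2 - 4 * Q) p)
    refine aux_dvd this ?_
    linear_combination (lucasU P Q (p ^ j * d)) * he
  · push_cast
    rw [mul_div_assoc]
end

section
/- Let P and Q be nonzero integers with D = P^2 - 4Q ≠ 0, let U = U(P,Q) and V = V(P,Q) be nondegenerate, and let p be an odd prime with p ∤ gcd(P,Q). Let n ≥ 1 satisfy gcd(p,n) = 1, assume 2n is not the entry point of p in U, and assume that if n is even then n is not the entry point of p in U. Then for every integer k ≥ 1 the rational number M^V_{p^k n} is p-integral and M^V_{p^k n} ≡ 1 (mod p^k); that is, there exist integers a, b with p ∤ b such that M^V_{p^k n} = 1 + p^k·(a/b). -/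
/-- Lucas sequence of the second kind: `V 0 = 2`, `V 1 = P`,
`V (n+2) = P * V (n+1) - Q * V n`. -/
def lucasV (P Q : ℤ) : ℕ → ℤ
  | 0 => 2
  | 1 => P
  | n + 2 => P * lucasV P Q (n + 1) - Q * lucasV P Q n

/-- Möbius dual of the Lucas sequence of the second kind:
`M^V_n = ∏_{d ∣ n} V_d ^ μ(n/d)`, as a rational number. -/
def mobiusDualV (P Q : ℤ) (n : ℕ) : ℚ :=
  ∏ d ∈ n.divisors, (lucasV P Q d : ℚ) ^ (ArithmeticFunction.moebius (n / d))

namespace LucasAux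

theorem exists_roots (P Q : ℤ) : ∃ x y : ℂ, x + y = P ∧ x * y = Q := by
  obtain ⟨s, hs⟩ := IsAlgClosed.exists_pow_nat_eq ((P : ℂ) ^ 2 - 4 * Q) (n := 2) (by norm_num)
  exact ⟨(P + s) / 2, (P - s) / 2, by ring, by linear_combination (-1 / 4 : ℂ) * hs⟩

theorem binetV {P Q : ℤ} {x y : ℂ} (h1 : x + y = P) (h2 : x * y = Q) (n : ℕ) :
    (lucasV P Q n : ℂ) = x ^ n + y ^ n := by
  induction n using Nat.strong_induction_on with
  | _ n ih =>
    match n with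
    | 0 => norm_num [lucasV]
    | 1 => simp [lucasV, h1]
    | n + 2 =>
      rw [lucasV]; push_cast
      rw [ih (n + 1) (by omega), ih n (by omega), ← h1, ← h2]; ring

theorem binetU {P Q : ℤ} {x y : ℂ} (h1 : x + y = P) (h2 : x * y = Q) (n : ℕ) :
    (x - y) * (lucasU P Q n : ℂ) = x ^ n - y ^ n := by
  induction n using Nat.strong_induction_on with
  | _ n ih =>
    match n with
    | 0 => norm_num [lucasU]
    | 1 => simp [lucasU]
    | n + 2 =>
      rw [lucasU]; push_cast
      linear_combination (P : ℂ) * ih (n + 1) (by omega) - (Q : ℂ) * ih n (by omega)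
        - (x ^ (n + 1) - y ^ (n + 1)) * h1 + (x ^ n - y ^ n) * h2

theorem lucasV_mul (P Q : ℤ) (m n : ℕ) :
    lucasV P Q (m * n) = lucasV (lucasV P Q m) (Q ^ m) n := by
  obtain ⟨x, y, h1, h2⟩ := exists_roots P Q
  have : (lucasV P Q (m * n) : ℂ) = lucasV (lucasV P Q m) (Q ^ m) n := by
    rw [binetV h1 h2, binetV (x := x ^ m) (y := y ^ m) (by rw [binetV h1 h2])
      (by push_cast; rw [← h2]; ring), pow_mul, pow_mul]
  exact_mod_cast this

theorem lucasU_two_mul (P Q : ℤ) (hD : P ^ 2 - 4 * Q ≠ 0) (n : ℕ) :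
    lucasU P Q (2 * n) = lucasU P Q n * lucasV P Q n := by
  obtain ⟨x, y, h1, h2⟩ := exists_roots P Q
  have hxy : x - y ≠ 0 := by
    intro h
    apply hD
    have : ((P ^ 2 - 4 * Q : ℤ) : ℂ) = 0 := by
      push_cast; rw [← h1, ← h2]; linear_combination (x - y) * h
    exact_mod_cast this
  have : (lucasU P Q (2 * n) : ℂ) = lucasU P Q n * lucasV P Q n := by
    apply mul_left_cancel₀ hxy
    rw [← mul_assoc, binetU h1 h2, binetU h1 h2, binetV h1 h2]; ring
  exact_mod_cast this

theorem lucas_sq (P Q : ℤ) (n : ℕ) :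
    lucasV P Q n ^ 2 - (P ^ 2 - 4 * Q) * lucasU P Q n ^ 2 = 4 * Q ^ n := by
  obtain ⟨x, y, h1, h2⟩ := exists_roots P Q
  have : (lucasV P Q n ^ 2 - (P ^ 2 - 4 * Q) * lucasU P Q n ^ 2 : ℂ) = 4 * Q ^ n := by
    rw [binetV h1 h2, ← h1, ← h2]
    have := binetU h1 h2 n
    linear_combination (-(x - y) * (lucasU P Q n : ℂ) - (x ^ n - y ^ n)) * this
  exact_mod_cast this

theorem lucasU_add (P Q : ℤ) (m n : ℕ) :
    lucasU P Q (m + n + 1) = lucasU P Q (m + 1) * lucasU P Q (n + 1)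
      - Q * lucasU P Q m * lucasU P Q n := by
  induction n using Nat.strong_induction_on with
  | _ n ih =>
    match n with
    | 0 => simp [lucasU]
    | 1 => simp [lucasU]; ring
    | n + 2 =>
      have e1 := ih (n + 1) (by omega)
      have e2 := ih n (by omega)
      have e3 : lucasU P Q (m + (n + 2) + 1) = P * lucasU P Q (m + (n + 1) + 1)
        - Q * lucasU P Q (m + n + 1) := by
        show lucasU P Q ((m + n + 1) + 2) = _
        rw [lucasU]; rfl
      have e4 : lucasU P Q (n + 2 + 1) = P * lucasU P Q (n + 1 + 1) - Q * lucasU P Q (n + 1) := by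
        rw [lucasU]
      have e5 : lucasU P Q (n + 2) = P * lucasU P Q (n + 1) - Q * lucasU P Q n := by
        rw [lucasU]
      rw [e3, e1, e2, e4, e5]; ring

theorem lucasU_cassini (P Q : ℤ) (n : ℕ) :
    lucasU P Q (n + 1) ^ 2 - P * lucasU P Q n * lucasU P Q (n + 1) + Q * lucasU P Q n ^ 2
      = Q ^ n := by
  induction n with
  | zero => simp [lucasU]
  | succ n ih =>
    rw [lucasU, pow_succ]
    linear_combination Q * ih

/-- congruence -/
theorem lucasV_congr {P Q P' Q' m : ℤ} (hP : P ≡ P' [ZMOD m]) (hQ : Q ≡ Q' [ZMOD m]) (n : ℕ) :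
    lucasV P Q n ≡ lucasV P' Q' n [ZMOD m] := by
  induction n using Nat.strong_induction_on with
  | _ n ih =>
    match n with
    | 0 => simp [lucasV]
    | 1 => simpa [lucasV] using hP
    | n + 2 =>
      rw [lucasV, lucasV]
      exact (hP.mul (ih _ (by omega))).sub (hQ.mul (ih _ (by omega)))

/-- integer version of x^i y^(p-i) + x^(p-i) y^i -/
def W (P Q : ℤ) (p i : ℕ) : ℤ :=
  if 2 * i ≤ p then Q ^ i * lucasV P Q (p - 2 * i) else Q ^ (p - i) * lucasV P Q (2 * i - p)

theorem W_binet {P Q : ℤ} {x y : ℂ} (h1 : x + y = P) (h2 : x * y = Q) (p i : ℕ) (hi : i ≤ p) :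
    (W P Q p i : ℂ) = x ^ i * y ^ (p - i) + y ^ i * x ^ (p - i) := by
  unfold W
  split_ifs with h
  · obtain ⟨t, rfl⟩ := Nat.exists_eq_add_of_le h
    have e1 : 2 * i + t - 2 * i = t := by omega
    have e2 : 2 * i + t - i = i + t := by omega
    rw [e1, e2]; push_cast; rw [binetV h1 h2, ← h2]; ring
  · obtain ⟨t, rfl⟩ := Nat.exists_eq_add_of_le hi
    obtain ⟨s, rfl⟩ := Nat.exists_eq_add_of_le (show t ≤ i by omega)
    have e1 : 2 * (t + s) - (t + s + t) = s := by omega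
    have e2 : t + s + t - (t + s) = t := by omega
    rw [e1, e2]; push_cast; rw [binetV h1 h2, ← h2]; ring

theorem W_sum (P Q : ℤ) (p : ℕ) :
    2 * P ^ p = ∑ i ∈ Finset.range (p + 1), (p.choose i : ℤ) * W P Q p i := by
  obtain ⟨x, y, h1, h2⟩ := exists_roots P Q
  have : (2 * P ^ p : ℂ) = ∑ i ∈ Finset.range (p + 1), (p.choose i : ℂ) * W P Q p i := by
    have : ∀ i ∈ Finset.range (p + 1), (p.choose i : ℂ) * W P Q p i =
        x ^ i * y ^ (p - i) * p.choose i + y ^ i * x ^ (p - i) * p.choose i := by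
      intro i hi
      rw [W_binet h1 h2 p i (by simp at hi; omega)]; ring
    rw [Finset.sum_congr rfl this, Finset.sum_add_distrib, ← add_pow, ← add_pow, add_comm y x, h1]
    ring
  exact_mod_cast this

theorem W_congr {P Q P' Q' m : ℤ} (hP : P ≡ P' [ZMOD m]) (hQ : Q ≡ Q' [ZMOD m]) (p i : ℕ) :
    W P Q p i ≡ W P' Q' p i [ZMOD m] := by
  unfold W
  split_ifs
  · exact (hQ.pow _).mul (lucasV_congr hP hQ _)
  · exact (hQ.pow _).mul (lucasV_congr hP hQ _)

theorem pow_congr {a b : ℤ} {p j : ℕ} (hj : 1 ≤ j) (h : a ≡ b [ZMOD (p : ℤ) ^ j]) :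
    a ^ p ≡ b ^ p [ZMOD (p : ℤ) ^ (j + 1)] := by
  obtain ⟨c, hc⟩ := h.symm.dvd
  have ha : a = b + (p : ℤ) ^ j * c := by linarith
  apply Int.ModEq.symm
  rw [Int.modEq_iff_dvd]
  obtain ⟨r, hr⟩ : ∃ r, (b + (p : ℤ) ^ j * c) ^ p =
      b ^ p + p * b ^ (p - 1) * ((p : ℤ) ^ j * c) + r * ((p : ℤ) ^ j * c) ^ 2 := by
    obtain ⟨r, hr⟩ := Polynomial.powAddExpansion b ((p : ℤ) ^ j * c) p
    exact ⟨r, by rw [hr]⟩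
  rw [ha, hr]
  obtain ⟨i, rfl⟩ := Nat.exists_eq_add_of_le hj
  refine ⟨b ^ (p - 1) * c + r * c ^ 2 * (p : ℤ) ^ i, ?_⟩
  ring

theorem two_W (P Q : ℤ) {p : ℕ} (hp : p.Prime) (hodd : Odd p) :
    2 * lucasV P Q p = 2 * P ^ p - p * ∑ i ∈ Finset.Ico 1 p,
      ((p.choose i / p : ℕ) : ℤ) * W P Q p i := by
  rw [W_sum, Finset.sum_range_succ, Finset.range_eq_Ico,
    Finset.sum_eq_sum_Ico_succ_bot hp.pos, Finset.mul_sum]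
  have : ∀ i ∈ Finset.Ico 1 p, (p : ℤ) * (((p.choose i / p : ℕ) : ℤ) * W P Q p i) =
      (p.choose i : ℤ) * W P Q p i := by
    intro i hi
    simp at hi
    have hd := hp.dvd_choose_self (by omega) hi.2
    rw [← mul_assoc]
    congr 1
    exact_mod_cast Nat.mul_div_cancel' hd
  rw [Finset.sum_congr rfl this]
  have hpp := hp.two_le
  simp [W, show ¬ (2 * p ≤ p) by omega, show 2 * p - p = p by omega]
  ring

theorem lucasV_p_congr {P Q P' Q' : ℤ} {p j : ℕ} (hp : p.Prime) (hodd : Odd p) (hj : 1 ≤ j)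
    (hP : P ≡ P' [ZMOD (p : ℤ) ^ j]) (hQ : Q ≡ Q' [ZMOD (p : ℤ) ^ j]) :
    lucasV P Q p ≡ lucasV P' Q' p [ZMOD (p : ℤ) ^ (j + 1)] := by
  have h2 : IsCoprime ((p : ℤ) ^ (j + 1)) 2 := by
    apply IsCoprime.pow_left
    have : Nat.Coprime p 2 := hodd.coprime_two_right
    exact_mod_cast Nat.isCoprime_iff_coprime.2 this
  have key : 2 * lucasV P Q p ≡ 2 * lucasV P' Q' p [ZMOD (p : ℤ) ^ (j + 1)] := by
    rw [two_W P Q hp hodd, two_W P' Q' hp hodd]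
    apply Int.ModEq.sub
    · exact (pow_congr hj hP).mul_left 2
    · rw [pow_succ, mul_comm ((p : ℤ) ^ j)]
      apply Int.ModEq.mul_left'
      exact Int.ModEq.sum fun i _ => (W_congr hP hQ p i).mul_left _
  rw [Int.modEq_iff_dvd] at key ⊢
  rw [← mul_sub] at key
  exact h2.dvd_of_dvd_mul_left key

theorem lucasV_p_modp {P Q : ℤ} {p : ℕ} (hp : p.Prime) (hodd : Odd p) :
    lucasV P Q p ≡ P [ZMOD p] := by
  have h2 : IsCoprime (p : ℤ) 2 := by
    have : Nat.Coprime p 2 := hodd.coprime_two_right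
    exact_mod_cast Nat.isCoprime_iff_coprime.2 this
  have : Fact p.Prime := ⟨hp⟩
  have hf : P ^ p ≡ P [ZMOD p] := by
    rw [← ZMod.intCast_eq_intCast_iff]; push_cast; exact ZMod.pow_card _
  refine Int.ModEq.trans ?_ hf
  have := two_W P Q hp hodd
  rw [Int.modEq_iff_dvd]
  apply h2.dvd_of_dvd_mul_left
  exact ⟨_, by rw [mul_sub, this, sub_sub_cancel]⟩

theorem lucasV_ppow_congr {p : ℕ} (hp : p.Prime) (hodd : Odd p) (k : ℕ) :
    ∀ {P Q P' Q' : ℤ} {j : ℕ}, 1 ≤ j → P ≡ P' [ZMOD (p : ℤ) ^ j] → Q ≡ Q' [ZMOD (p : ℤ) ^ j] →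
    lucasV P Q (p ^ k) ≡ lucasV P' Q' (p ^ k) [ZMOD (p : ℤ) ^ (j + k)] := by
  induction k with
  | zero => intro P Q P' Q' j hj h1 h2; simpa [lucasV] using h1
  | succ k ih =>
    intro P Q P' Q' j hj h1 h2
    rw [pow_succ', lucasV_mul, lucasV_mul]
    have := ih (j := j + 1) (by omega) (lucasV_p_congr hp hodd hj h1 h2) (pow_congr hj h2)
    rwa [show j + (k + 1) = j + 1 + k by ring]

theorem gauss {p : ℕ} (hp : p.Prime) (hodd : Odd p) (P Q : ℤ) (k d : ℕ) :
    lucasV P Q (p ^ (k + 1) * d) ≡ lucasV P Q (p ^ k * d) [ZMOD (p : ℤ) ^ (k + 1)] := by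
  rw [mul_comm, lucasV_mul, mul_comm, lucasV_mul, show p ^ (k + 1) = p * p ^ k from pow_succ' p k,
    lucasV_mul]
  have : Fact p.Prime := ⟨hp⟩
  have := lucasV_ppow_congr hp hodd k (P := lucasV (lucasV P Q d) (Q ^ d) p)
    (Q := (Q ^ d) ^ p) (P' := lucasV P Q d) (Q' := Q ^ d) (j := 1) le_rfl
    (by rw [pow_one]; exact lucasV_p_modp hp hodd)
    (by rw [pow_one, ← ZMod.intCast_eq_intCast_iff]; push_cast; exact ZMod.pow_card _)
  rwa [add_comm 1 k] at this

theorem modp {p : ℕ} (hp : p.Prime) (hodd : Odd p) (P Q : ℤ) (k d : ℕ) :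
    lucasV P Q (p ^ k * d) ≡ lucasV P Q d [ZMOD p] := by
  induction k with
  | zero => simp
  | succ k ih =>
    exact ((gauss hp hodd P Q k d).of_dvd (dvd_pow_self _ (by omega))).trans ih

theorem odd_expand (v q : ℤ) (t : ℕ) :
    (v ^ 2 ∣ lucasV v q (2 * t) - 2 * (-q) ^ t) ∧
    (v ^ 2 ∣ lucasV v q (2 * t + 1) - (2 * t + 1) * (-q) ^ t * v) := by
  induction t with
  | zero => simp [lucasV]
  | succ t ih =>
    obtain ⟨⟨a, ha⟩, ⟨b, hb⟩⟩ := ih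
    have e1 : lucasV v q (2 * (t + 1)) = v * lucasV v q (2 * t + 1) - q * lucasV v q (2 * t) := by
      rw [show 2 * (t + 1) = 2 * t + 2 by ring, lucasV]
    have e2 : lucasV v q (2 * (t + 1) + 1) =
        v * lucasV v q (2 * (t + 1)) - q * lucasV v q (2 * t + 1) := by
      rw [show 2 * (t + 1) + 1 = 2 * t + 1 + 2 by ring, lucasV]; ring_nf
    have h1 : v ^ 2 ∣ lucasV v q (2 * (t + 1)) - 2 * (-q) ^ (t + 1) :=
      ⟨(2 * t + 1) * (-q) ^ t + v * b - q * a, by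
        rw [e1, pow_succ]; linear_combination v * hb - q * ha⟩
    refine ⟨h1, ?_⟩
    obtain ⟨c, hc⟩ := h1
    refine ⟨v * c - q * b, ?_⟩
    rw [e2]; push_cast; rw [pow_succ] at hc ⊢
    linear_combination v * hc - q * hb

/-- odd multiple factorisation -/
theorem odd_factor (v q : ℤ) (t : ℕ) :
    ∃ T : ℤ, lucasV v q (2 * t + 1) = v * T ∧ v ∣ T - (2 * t + 1) * (-q) ^ t := by
  obtain ⟨c, hc⟩ := (odd_expand v q t).2
  exact ⟨(2 * t + 1) * (-q) ^ t + v * c, by linear_combination hc, ⟨c, by ring⟩⟩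

theorem ppow_dvd {p : ℕ} (hodd : Odd p) (P Q : ℤ) (w : ℕ) (hw : (p : ℤ) ∣ lucasV P Q w) (j : ℕ) :
    (p : ℤ) ^ (j + 1) ∣ lucasV P Q (p ^ j * w) := by
  induction j with
  | zero => simpa using hw
  | succ j ih =>
    obtain ⟨t, ht⟩ := hodd
    rw [show p ^ (j + 1) * w = (p ^ j * w) * p by ring, lucasV_mul]
    obtain ⟨T, hT, c, hc⟩ := odd_factor (lucasV P Q (p ^ j * w)) (Q ^ (p ^ j * w)) t
    have hpt : (p : ℤ) ∣ T := by
      have e : T = p * (-Q ^ (p ^ j * w)) ^ t + lucasV P Q (p ^ j * w) * c := by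
        rw [show (p : ℤ) = 2 * t + 1 by exact_mod_cast ht]; linear_combination hc
      rw [e]
      exact dvd_add (dvd_mul_right _ _)
        (Dvd.dvd.mul_right ((dvd_pow_self _ (by omega)).trans ih) _)
    have : lucasV (lucasV P Q (p ^ j * w)) (Q ^ (p ^ j * w)) p
      = lucasV P Q (p ^ j * w) * T := by rw [← hT, ← ht]
    rw [this, pow_succ]
    exact mul_dvd_mul ih hpt

/-- being `1` modulo `p^k` in the localization at `p` -/
def IsOne (p k : ℕ) (x : ℚ) : Prop :=
  ∃ a b : ℤ, ¬ (p : ℤ) ∣ b ∧ x = 1 + (p : ℚ) ^ k * ((a : ℚ) / (b : ℚ))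

theorem IsOne.one {p k : ℕ} (hp : p.Prime) : IsOne p k 1 :=
  ⟨0, 1, fun h => hp.one_lt.ne' (by
    have := Int.natCast_dvd_natCast.1 (by exact_mod_cast h : (p : ℤ) ∣ ((1 : ℕ) : ℤ))
    exact Nat.dvd_one.1 this), by simp⟩

theorem ne_zero_of_not_dvd {p : ℕ} {b : ℤ} (h : ¬ (p : ℤ) ∣ b) : (b : ℚ) ≠ 0 := by
  intro hb
  apply h
  have : b = 0 := by exact_mod_cast hb
  simp [this]

theorem isOne_div {p k : ℕ} {A B : ℤ} (h : A ≡ B [ZMOD (p : ℤ) ^ k]) (hB : ¬ (p : ℤ) ∣ B) :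
    IsOne p k ((A : ℚ) / B) := by
  obtain ⟨c, hc⟩ := h.symm.dvd
  have hB0 := ne_zero_of_not_dvd hB
  refine ⟨c, B, hB, ?_⟩
  have : (A : ℚ) - B = (p : ℚ) ^ k * c := by exact_mod_cast hc
  field_simp
  linarith

theorem IsOne.mul {p k : ℕ} (hp : p.Prime) {x y : ℚ} (hx : IsOne p k x) (hy : IsOne p k y) :
    IsOne p k (x * y) := by
  obtain ⟨a, b, hb, rfl⟩ := hx
  obtain ⟨c, d, hd, rfl⟩ := hy
  have hb0 := ne_zero_of_not_dvd hb
  have hd0 := ne_zero_of_not_dvd hd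
  refine ⟨a * d + c * b + (p : ℤ) ^ k * a * c, b * d, ?_, ?_⟩
  · intro h
    rcases (Nat.prime_iff_prime_int.1 hp).dvd_or_dvd h with h | h
    · exact hb h
    · exact hd h
  · push_cast
    field_simp
    ring

theorem IsOne.inv {p k : ℕ} (hk : 1 ≤ k) {x : ℚ} (hx : IsOne p k x) :
    IsOne p k x⁻¹ := by
  obtain ⟨a, b, hb, rfl⟩ := hx
  have hb0 := ne_zero_of_not_dvd hb
  have h : ¬ (p : ℤ) ∣ b + (p : ℤ) ^ k * a := by
    intro h
    apply hb
    have h2 : (p : ℤ) ∣ (p : ℤ) ^ k * a := Dvd.dvd.mul_right (dvd_pow_self _ (by omega)) _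
    exact (dvd_add_left h2).1 h
  have h0 := ne_zero_of_not_dvd h
  have := isOne_div (p := p) (k := k) (A := b) (B := b + (p : ℤ) ^ k * a) (by
    rw [Int.modEq_iff_dvd]; exact ⟨a, by ring⟩) h
  convert this using 1
  push_cast at h0 ⊢
  have e : (1 + (p : ℚ) ^ k * ((a : ℚ) / b)) = (b + (p : ℚ) ^ k * a) / b := by
    field_simp
  rw [e, inv_div]

theorem IsOne.zpow_moebius {p k : ℕ} (hp : p.Prime) (hk : 1 ≤ k) {x : ℚ} (hx : IsOne p k x)
    (m : ℕ) : IsOne p k (x ^ (ArithmeticFunction.moebius m)) := by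
  rcases ArithmeticFunction.moebius_eq_or m with h | h | h <;> rw [h]
  · simpa using IsOne.one hp
  · simpa using hx
  · simpa using hx.inv hk

theorem IsOne.prod {p k : ℕ} (hp : p.Prime) (s : Finset ℕ) (f : ℕ → ℚ)
    (h : ∀ d ∈ s, IsOne p k (f d)) : IsOne p k (∏ d ∈ s, f d) := by
  induction s using Finset.induction_on with
  | empty => simpa using IsOne.one hp
  | insert a s ha ih =>
    rw [Finset.prod_insert ha]
    exact (h a (Finset.mem_insert_self _ _)).mul hp
      (ih fun d hd => h d (Finset.mem_insert_of_mem hd))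

theorem moebius_div_sum (n : ℕ) (hn : 1 ≤ n) :
    ∑ d ∈ n.divisors, ArithmeticFunction.moebius (n / d) = if n = 1 then 1 else 0 := by
  rw [Nat.sum_div_divisors n (fun d => ArithmeticFunction.moebius d),
    ← ArithmeticFunction.coe_mul_zeta_apply, ArithmeticFunction.moebius_mul_coe_zeta,
    ArithmeticFunction.one_apply]

theorem moebius_mult_sum (n c : ℕ) (hn : 1 ≤ n) :
    ∑ d ∈ n.divisors, (if c ∣ d then ArithmeticFunction.moebius (n / d) else 0)
      = if n = c then 1 else 0 := by
  by_cases hc : c ∣ n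
  · obtain ⟨N, rfl⟩ := hc
    have hc0 : 0 < c := Nat.pos_of_ne_zero (by rintro rfl; simp at hn)
    have hN : 1 ≤ N := Nat.pos_of_ne_zero (by rintro rfl; simp at hn)
    rw [← Finset.sum_filter]
    have : (c * N).divisors.filter (c ∣ ·) = N.divisors.image (c * ·) := by
      ext d
      simp only [Finset.mem_filter, Nat.mem_divisors, Finset.mem_image]
      constructor
      · rintro ⟨⟨h1, h2⟩, e, rfl⟩
        exact ⟨e, ⟨(Nat.mul_dvd_mul_iff_left hc0).1 h1, by omega⟩, rfl⟩
      · rintro ⟨e, ⟨h1, h2⟩, rfl⟩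
        exact ⟨⟨Nat.mul_dvd_mul_left _ h1, by positivity⟩, dvd_mul_right _ _⟩
    rw [this, Finset.sum_image (fun a _ b _ h => Nat.eq_of_mul_eq_mul_left hc0 h)]
    simp only [Nat.mul_div_mul_left _ _ hc0]
    rw [moebius_div_sum N hN]
    congr 1
    simp only [eq_iff_iff]
    constructor
    · rintro rfl; simp
    · intro h
      exact Nat.eq_of_mul_eq_mul_left hc0 (by omega)
  · rw [if_neg (by rintro rfl; exact hc dvd_rfl)]
    apply Finset.sum_eq_zero
    intro d hd
    rw [if_neg]
    intro h
    exact hc (h.trans (Nat.dvd_of_mem_divisors hd))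

theorem mobiusDual_eq (P Q : ℤ) {p n k : ℕ} (hp : p.Prime) (hn : 1 ≤ n) (hpn : Nat.Coprime p n)
    (hndV : ∀ m : ℕ, 1 ≤ m → lucasV P Q m ≠ 0) :
    mobiusDualV P Q (p ^ (k + 1) * n) = ∏ d ∈ n.divisors,
      ((lucasV P Q (p ^ (k + 1) * d) : ℚ) / lucasV P Q (p ^ k * d)) ^
        (ArithmeticFunction.moebius (n / d)) := by
  have hcop : Nat.Coprime (p ^ (k + 1)) n := Nat.Coprime.pow_left _ hpn
  unfold mobiusDualV
  rw [Nat.divisors_mul, Finset.mul_def,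
    Finset.prod_image (f := fun d => (lucasV P Q d : ℚ) ^
      (ArithmeticFunction.moebius (p ^ (k + 1) * n / d))) hcop.mul_injOn_divisors,
    Finset.prod_product_right]
  apply Finset.prod_congr rfl
  intro d hd
  have hdn := Nat.dvd_of_mem_divisors hd
  have hd0 : 0 < d := Nat.pos_of_mem_divisors hd
  have hmu : ∀ i, i ≤ k + 1 → ArithmeticFunction.moebius (p ^ (k + 1) * n / (p ^ i * d)) =
      ArithmeticFunction.moebius (p ^ (k + 1 - i)) * ArithmeticFunction.moebius (n / d) := by
    intro i hi
    rw [Nat.mul_div_mul_comm (pow_dvd_pow p hi) hdn, Nat.pow_div hi hp.pos]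
    apply ArithmeticFunction.isMultiplicative_moebius.map_mul_of_coprime
    exact Nat.Coprime.pow_left _ (hpn.coprime_dvd_right (Nat.div_dvd_of_dvd hdn))
  rw [Nat.prod_divisors_prime_pow hp, Finset.prod_range_succ, Finset.prod_range_succ,
    Finset.prod_eq_one, one_mul, hmu k (by omega), hmu (k + 1) le_rfl]
  · rw [show k + 1 - k = 1 by omega, Nat.sub_self, pow_one, pow_zero,
      ArithmeticFunction.moebius_apply_prime hp, ArithmeticFunction.moebius_apply_one,
      one_mul, div_zpow, neg_one_mul, zpow_neg, div_eq_mul_inv, mul_comm]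
  · intro i hi
    simp only [Finset.mem_range] at hi
    rw [hmu i (by omega), ArithmeticFunction.moebius_apply_prime_pow hp (by omega),
      if_neg (by omega)]
    simp

theorem entry_dvd {P Q : ℤ} {p z : ℕ} (hp : p.Prime) (hQ : ¬ (p : ℤ) ∣ Q)
    (hz : 1 ≤ z) (hzU : (p : ℤ) ∣ lucasU P Q z)
    (hmin : ∀ m : ℕ, 1 ≤ m → m < z → ¬ (p : ℤ) ∣ lucasU P Q m) (m : ℕ) :
    (p : ℤ) ∣ lucasU P Q m ↔ z ∣ m := by
  have hp' := Nat.prime_iff_prime_int.1 hp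
  have hz1 : ¬ (p : ℤ) ∣ lucasU P Q (z + 1) := by
    intro h
    have := lucasU_cassini P Q z
    apply hQ
    apply hp'.dvd_of_dvd_pow (n := z)
    rw [← this]
    obtain ⟨a, ha⟩ := h
    obtain ⟨b, hb⟩ := hzU
    rw [ha, hb]
    exact ⟨p * a ^ 2 - P * b * (p * a) + Q * p * b ^ 2, by ring⟩
  have step : ∀ j, (p : ℤ) ∣ lucasU P Q (z + j) ↔ (p : ℤ) ∣ lucasU P Q j := by
    intro j
    rcases j with _ | j
    · simp [lucasU, hzU]
    · have e := lucasU_add P Q z j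
      rw [show z + (j + 1) = z + j + 1 by ring, e]
      rw [dvd_sub_left (Dvd.dvd.mul_right (hzU.mul_left _) _)]
      constructor
      · intro h
        exact (hp'.dvd_or_dvd h).resolve_left hz1
      · intro h; exact h.mul_left _
  induction m using Nat.strong_induction_on with
  | _ m ih =>
    by_cases hm : m < z
    · rcases Nat.eq_zero_or_pos m with rfl | h0
      · simp [lucasU]
      · constructor
        · intro h; exact absurd h (hmin m h0 hm)
        · intro h; exact absurd (Nat.le_of_dvd h0 h) (by omega)
    · obtain ⟨j, rfl⟩ := Nat.exists_eq_add_of_le (not_lt.1 hm)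
      exact (step j).trans ((ih j (by omega) ).trans (by simp))

theorem not_dvd_Q {P Q : ℤ} {p d : ℕ} (hp : p.Prime) (hpPQ : ¬ p ∣ Int.gcd P Q) (hd : 1 ≤ d)
    (h : (p : ℤ) ∣ lucasV P Q d) : ¬ (p : ℤ) ∣ Q := by
  intro hQ
  have hp' := Nat.prime_iff_prime_int.1 hp
  have : ∀ m, lucasV P Q (m + 1) ≡ P ^ (m + 1) [ZMOD p] := by
    intro m
    induction m with
    | zero => simp [lucasV]
    | succ m ih =>
      rw [lucasV, pow_succ']
      have h0 : Q * lucasV P Q m ≡ 0 [ZMOD p] :=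
        (Int.modEq_zero_iff_dvd).2 (hQ.mul_right _)
      simpa using (ih.mul_left P).sub h0
  obtain ⟨e, rfl⟩ := Nat.exists_eq_add_of_le' hd
  have h1 := (this e).dvd_iff.1 h
  have hP := hp'.dvd_of_dvd_pow h1
  exact hpPQ (by exact_mod_cast Int.dvd_coe_gcd hP hQ)

/-- structure of the set of `d` with `p ∣ V_d` -/
theorem exists_w {P Q : ℤ} {p d₀ : ℕ} (hp : p.Prime) (hodd : Odd p) (hD : P ^ 2 - 4 * Q ≠ 0)
    (hQ : ¬ (p : ℤ) ∣ Q) (hd : 1 ≤ d₀) (h : (p : ℤ) ∣ lucasV P Q d₀) :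
    ∃ w : ℕ, 1 ≤ w ∧ (p : ℤ) ∣ lucasV P Q w ∧
      ((p : ℤ) ∣ lucasU P Q (2 * w) ∧ ∀ m : ℕ, 1 ≤ m → m < 2 * w → ¬ (p : ℤ) ∣ lucasU P Q m) ∧
      ∀ d, (p : ℤ) ∣ lucasV P Q d → w ∣ d ∧ ¬ 2 * w ∣ d := by
  classical
  have hp' := Nat.prime_iff_prime_int.1 hp
  have ex : ∃ m, 1 ≤ m ∧ (p : ℤ) ∣ lucasU P Q m :=
    ⟨2 * d₀, by omega, by rw [lucasU_two_mul P Q hD]; exact h.mul_left _⟩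
  obtain ⟨hz1, hz2⟩ := Nat.find_spec ex
  have hz3 : ∀ m : ℕ, 1 ≤ m → m < Nat.find ex → ¬ (p : ℤ) ∣ lucasU P Q m := by
    intro m h1 h2 h3
    exact Nat.find_min ex h2 ⟨h1, h3⟩
  generalize Nat.find ex = z at hz1 hz2 hz3
  have key := entry_dvd hp hQ hz1 hz2 hz3
  have all : ∀ d, (p : ℤ) ∣ lucasV P Q d → z ∣ 2 * d ∧ ¬ z ∣ d := by
    intro d hd
    rw [← key, ← key]
    refine ⟨by rw [lucasU_two_mul P Q hD]; exact hd.mul_left _, ?_⟩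
    intro hU
    have e := lucas_sq P Q d
    have h4 : (p : ℤ) ∣ 4 * Q ^ d := by
      rw [← e]
      exact dvd_sub (dvd_pow hd (by norm_num)) ((dvd_pow hU (by norm_num)).mul_left _)
    rcases hp'.dvd_or_dvd h4 with h4 | h4
    · have h5 : (p : ℤ) ∣ 2 ^ 2 := by simpa using h4
      have h6 := hp'.dvd_of_dvd_pow h5
      have h7 : p ∣ 2 := by exact_mod_cast h6
      have := (Nat.prime_dvd_prime_iff_eq hp Nat.prime_two).1 h7
      subst this
      exact absurd hodd (by decide)
    · exact hQ (hp'.dvd_of_dvd_pow h4)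
  have hev : 2 ∣ z := by
    by_contra hc
    have hcop : Nat.Coprime z 2 := ((Nat.Prime.coprime_iff_not_dvd Nat.prime_two).2 hc).symm
    exact (all d₀ h).2 (hcop.dvd_of_dvd_mul_left (all d₀ h).1)
  obtain ⟨w, rfl⟩ := hev
  refine ⟨w, by omega, ?_, ⟨hz2, hz3⟩, fun d hd => ⟨?_, (all d hd).2⟩⟩
  · have h1 := hz2
    rw [lucasU_two_mul P Q hD] at h1
    exact (hp'.dvd_or_dvd h1).resolve_left (hz3 w (by omega) (by omega))
  · exact (Nat.mul_dvd_mul_iff_left (by norm_num)).1 (all d hd).1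

theorem ratio_isOne {P Q : ℤ} {p k w t : ℕ} (hp : p.Prime) (hodd : Odd p)
    (hQ : ¬ (p : ℤ) ∣ Q) (hw : 1 ≤ w) (hpw : (p : ℤ) ∣ lucasV P Q w) (hpe : ¬ p ∣ 2 * t + 1)
    (hndV : ∀ m : ℕ, 1 ≤ m → lucasV P Q m ≠ 0) :
    IsOne p (k + 1) (((lucasV P Q (p ^ (k + 1) * (w * (2 * t + 1))) : ℚ) /
        lucasV P Q (p ^ k * (w * (2 * t + 1)))) /
      ((lucasV P Q (p ^ (k + 1) * w) : ℚ) / lucasV P Q (p ^ k * w))) := by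
  have hp' := Nat.prime_iff_prime_int.1 hp
  have : Fact p.Prime := ⟨hp⟩
  obtain ⟨T1, h1, c1⟩ := odd_factor (lucasV P Q (p ^ (k + 1) * w)) (Q ^ (p ^ (k + 1) * w)) t
  obtain ⟨T0, h0, c0⟩ := odd_factor (lucasV P Q (p ^ k * w)) (Q ^ (p ^ k * w)) t
  rw [← lucasV_mul] at h1 h0
  have hv1 : (lucasV P Q (p ^ (k + 1) * w) : ℚ) ≠ 0 := by
    exact_mod_cast hndV _ (Nat.mul_pos (pow_pos hp.pos _) hw)
  have hv0 : (lucasV P Q (p ^ k * w) : ℚ) ≠ 0 := by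
    exact_mod_cast hndV _ (Nat.mul_pos (pow_pos hp.pos _) hw)
  have d1 : T1 ≡ (2 * t + 1) * (-Q ^ (p ^ (k + 1) * w)) ^ t [ZMOD (p : ℤ) ^ (k + 1)] := by
    apply Int.ModEq.symm
    rw [Int.modEq_iff_dvd]
    exact ((pow_dvd_pow _ (by omega)).trans (ppow_dvd hodd P Q w hpw (k + 1))).trans c1
  have d0 : T0 ≡ (2 * t + 1) * (-Q ^ (p ^ k * w)) ^ t [ZMOD (p : ℤ) ^ (k + 1)] := by
    apply Int.ModEq.symm
    rw [Int.modEq_iff_dvd]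
    exact (ppow_dvd hodd P Q w hpw k).trans c0
  have hq : Q ^ (p ^ (k + 1) * w) ≡ Q ^ (p ^ k * w) [ZMOD (p : ℤ) ^ (k + 1)] := by
    have hf : (Q ^ w) ≡ (Q ^ w) ^ p [ZMOD p] := by
      rw [← ZMod.intCast_eq_intCast_iff]; push_cast; exact (ZMod.pow_card _).symm
    have := dvd_sub_pow_of_dvd_sub hf.dvd k
    apply Int.ModEq.symm
    rw [Int.modEq_iff_dvd]
    have a1 : Q ^ (p ^ (k + 1) * w) = ((Q ^ w) ^ p) ^ p ^ k := by
      rw [← pow_mul, ← pow_mul]; congr 1; ring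
    have a2 : Q ^ (p ^ k * w) = (Q ^ w) ^ p ^ k := by
      rw [← pow_mul]; congr 1; ring
    rw [a1, a2]
    exact this
  have hT : T1 ≡ T0 [ZMOD (p : ℤ) ^ (k + 1)] :=
    d1.trans (((hq.neg.pow t).mul_left _).trans d0.symm)
  have hT0 : ¬ (p : ℤ) ∣ T0 := by
    intro h
    have h2 := (d0.of_dvd (dvd_pow_self (p : ℤ) (Nat.succ_ne_zero k))).dvd_iff.1 h
    rcases hp'.dvd_or_dvd h2 with h3 | h3
    · exact hpe (by exact_mod_cast h3)
    · have h4 := hp'.dvd_of_dvd_pow h3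
      rw [dvd_neg] at h4
      exact hQ (hp'.dvd_of_dvd_pow h4)
  have hT0' := ne_zero_of_not_dvd hT0
  convert isOne_div hT hT0 using 1
  rw [← mul_assoc, ← mul_assoc, h1, h0]
  push_cast
  field_simp

end LucasAux

theorem stmt_8 (P Q : ℤ) (hP : P ≠ 0) (hQ : Q ≠ 0) (hD : P ^ 2 - 4 * Q ≠ 0)
    (hndU : ∀ m : ℕ, 1 ≤ m → lucasU P Q m ≠ 0)
    (hndV : ∀ m : ℕ, 1 ≤ m → lucasV P Q m ≠ 0)
    (p : ℕ) (hp : p.Prime) (hodd : Odd p) (hpPQ : ¬ p ∣ Int.gcd P Q)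
    (n : ℕ) (hn : 1 ≤ n) (hpn : Nat.gcd p n = 1)
    (hz2 : ¬ ((p : ℤ) ∣ lucasU P Q (2 * n) ∧
      ∀ m : ℕ, 1 ≤ m → m < 2 * n → ¬ (p : ℤ) ∣ lucasU P Q m))
    (hzeven : Even n → ¬ ((p : ℤ) ∣ lucasU P Q n ∧
      ∀ m : ℕ, 1 ≤ m → m < n → ¬ (p : ℤ) ∣ lucasU P Q m))
    (k : ℕ) (hk : 1 ≤ k) :
    ∃ a b : ℤ, ¬ (p : ℤ) ∣ b ∧
      mobiusDualV P Q (p ^ k * n) = 1 + (p : ℚ) ^ k * ((a : ℚ) / (b : ℚ)) := by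
  obtain ⟨k, rfl⟩ := Nat.exists_eq_add_of_le' hk
  have hpn' : Nat.Coprime p n := hpn
  change LucasAux.IsOne p (k + 1) _
  rw [LucasAux.mobiusDual_eq P Q hp hn hpn' hndV]
  have unit_case : ∀ d, ¬ (p : ℤ) ∣ lucasV P Q d → LucasAux.IsOne p (k + 1)
      ((lucasV P Q (p ^ (k + 1) * d) : ℚ) / lucasV P Q (p ^ k * d)) := by
    intro d hd
    apply LucasAux.isOne_div (LucasAux.gauss hp hodd P Q k d)
    intro h
    exact hd ((LucasAux.modp hp hodd P Q k d).dvd_iff.1 h)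
  by_cases hex : ∃ d, 1 ≤ d ∧ (p : ℤ) ∣ lucasV P Q d
  · obtain ⟨d₀, hd₀, hpd₀⟩ := hex
    have hpQ := LucasAux.not_dvd_Q hp hpPQ hd₀ hpd₀
    obtain ⟨w, hw, hpw, hz, hall⟩ := LucasAux.exists_w hp hodd hD hpQ hd₀ hpd₀
    have hnw : n ≠ w := by
      rintro rfl; exact hz2 hz
    have hn2w : n ≠ 2 * w := by
      rintro rfl; exact hzeven (even_two_mul w) hz
    set f : ℕ → ℚ := fun d => (lucasV P Q (p ^ (k + 1) * d) : ℚ) / lucasV P Q (p ^ k * d) with hf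
    have hR : f w ≠ 0 := by
      apply div_ne_zero
      · exact_mod_cast hndV _ (Nat.mul_pos (pow_pos hp.pos _) hw)
      · exact_mod_cast hndV _ (Nat.mul_pos (pow_pos hp.pos _) hw)
    let ε : ℕ → ℤ := fun d => (if w ∣ d then 1 else 0) - (if 2 * w ∣ d then 1 else 0)
    have hsum : ∑ d ∈ n.divisors, ε d * ArithmeticFunction.moebius (n / d) = 0 := by
      have e1 := LucasAux.moebius_mult_sum n w hn
      have e2 := LucasAux.moebius_mult_sum n (2 * w) hn
      rw [if_neg hnw] at e1
      rw [if_neg hn2w] at e2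
      have e3 := congrArg₂ (· - ·) e1 e2
      simp only [← Finset.sum_sub_distrib, sub_zero] at e3
      refine Eq.trans (Finset.sum_congr rfl ?_) e3
      intro d _
      simp only [ε, sub_mul, ite_mul, one_mul, zero_mul]
    have hprod : ∏ d ∈ n.divisors, f d ^ (ArithmeticFunction.moebius (n / d)) =
        ∏ d ∈ n.divisors, (f d / f w ^ ε d) ^ (ArithmeticFunction.moebius (n / d)) := by
      have h1 : ∏ d ∈ n.divisors, (f w ^ ε d) ^ (ArithmeticFunction.moebius (n / d)) = 1 := by
        have : ∀ s : Finset ℕ, ∏ d ∈ s, (f w ^ ε d) ^ (ArithmeticFunction.moebius (n / d)) =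
            f w ^ (∑ d ∈ s, ε d * ArithmeticFunction.moebius (n / d)) := by
          intro s
          induction s using Finset.induction_on with
          | empty => simp
          | insert a s ha ih =>
            rw [Finset.prod_insert ha, Finset.sum_insert ha, zpow_add₀ hR, ih, zpow_mul]
        rw [this, hsum, zpow_zero]
      simp only [div_zpow]
      rw [Finset.prod_div_distrib, h1, div_one]
    change LucasAux.IsOne p (k + 1) (∏ d ∈ n.divisors, f d ^ (ArithmeticFunction.moebius (n / d)))
    rw [hprod]
    apply LucasAux.IsOne.prod hp
    intro d hd
    apply LucasAux.IsOne.zpow_moebius hp hk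
    have hdn := Nat.dvd_of_mem_divisors hd
    by_cases h1 : w ∣ d
    · by_cases h2 : 2 * w ∣ d
      · have : ε d = 0 := by simp [ε, h1, h2]
        rw [this, zpow_zero, div_one]
        exact unit_case d fun h => (hall d h).2 h2
      · have : ε d = 1 := by simp [ε, h1, h2]
        rw [this, zpow_one]
        obtain ⟨e, rfl⟩ := h1
        have he : Odd e := by
          rw [← Nat.not_even_iff_odd]
          rintro ⟨s, rfl⟩
          exact h2 ⟨s, by ring⟩
        obtain ⟨t, rfl⟩ := he
        apply LucasAux.ratio_isOne hp hodd hpQ hw hpw _ hndV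
        intro h
        have h3 : p ∣ n := (h.trans (dvd_mul_left _ _)).trans hdn
        exact ((Nat.Prime.coprime_iff_not_dvd hp).1 hpn') h3
    · have h2 : ¬ 2 * w ∣ d := fun h => h1 ((dvd_mul_left _ _).trans h)
      have : ε d = 0 := by simp [ε, h1, h2]
      rw [this, zpow_zero, div_one]
      exact unit_case d fun h => h1 (hall d h).1
  · apply LucasAux.IsOne.prod hp
    intro d hd
    apply LucasAux.IsOne.zpow_moebius hp hk
    exact unit_case d fun h => hex ⟨d, Nat.pos_of_mem_divisors hd, h⟩
end
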